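/- arXiv:2408.01277 — 8 statements merged into one kernel-verified Lean document; each statement's English description precedes it below -/
import Mathlib

section
/- Let p be a prime and G an abelian p-group. Then G is relatively Hopfian if and only if every subgroup H of G satisfying G/H ≅ G is a bounded subgroup of p^ω G. -/
open Function

universe u

section Defs

variable (G : Type u) [AddCommGroup G]

/-- An abelian group is *Hopfian* if every surjective endomorphism is injective. -/
def Hopfian : Prop := ∀ φ : G →+ G, Surjective φ → Injective φ

/-- An abelian group `G` is *relatively Hopfian* if for every abelian group `A`,
every surjective homomorphism `G → G ⊕ A` forces `A = 0`. -/
def RelativelyHopfian : Prop :=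
  ∀ (A : Type u) [AddCommGroup A], ∀ φ : G →+ G × A, Surjective φ → Subsingleton A

/-- An abelian group `G` is *directly finite* if `G ≅ G ⊕ A` implies `A = 0`. -/
def DirectlyFinite : Prop :=
  ∀ (A : Type u) [AddCommGroup A], (G ≃+ G × A) → Subsingleton A

/-- The multiplication-by-`n` endomorphism of `G`. -/
def nsmulHom (n : ℕ) : G →+ G where
  toFun x := n • x
  map_zero' := smul_zero n
  map_add' := smul_add n

/-- The subgroup `nG` of `G`. -/
def smulSub (n : ℕ) : AddSubgroup G := (nsmulHom G n).range

/-- The subgroup `G[n] = {x : G | n • x = 0}`. -/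
def torsionSub (n : ℕ) : AddSubgroup G := (nsmulHom G n).ker

/-- A subgroup `H ≤ G` is *pure* if `H ∩ nG = nH` for every positive integer `n`. -/
def IsPureSubgroup {G : Type u} [AddCommGroup G] (H : AddSubgroup G) : Prop :=
  ∀ n : ℕ, 0 < n → ∀ x ∈ H, (∃ g : G, n • g = x) → ∃ y ∈ H, n • y = x

/-- An abelian group `G` is *weakly Hopfian* if every surjective endomorphism of `G`
with pure kernel is injective. -/
def WeaklyHopfian : Prop :=
  ∀ φ : G →+ G, Surjective φ → IsPureSubgroup φ.ker → Injective φ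

/-- `G` is an (abelian) `p`-group: every element has order a power of `p`. -/
def IsPAddGroup (p : ℕ) : Prop := ∀ x : G, ∃ n : ℕ, p ^ n • x = 0

/-- The subgroup `p^ω G = ⋂ₙ p^n G`. -/
def pOmega (p : ℕ) : AddSubgroup G := ⨅ n : ℕ, smulSub G (p ^ n)

/-- A subgroup is *bounded* if it is annihilated by some positive integer. -/
def IsBoundedSubgroup {G : Type u} [AddCommGroup G] (H : AddSubgroup G) : Prop :=
  ∃ n : ℕ, 0 < n ∧ ∀ x ∈ H, n • x = 0

/-- A subgroup is *divisible* (as a group in its own right). -/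
def IsDivisibleSubgroup {G : Type u} [AddCommGroup G] (H : AddSubgroup G) : Prop :=
  ∀ n : ℕ, 0 < n → ∀ x ∈ H, ∃ y ∈ H, n • y = x

/-- A *divisible* abelian group. -/
def DivisibleGroup : Prop := ∀ n : ℕ, 0 < n → ∀ x : G, ∃ y : G, n • y = x

/-- A *reduced* abelian group: its only divisible subgroup is trivial. -/
def ReducedGroup : Prop := ∀ H : AddSubgroup G, IsDivisibleSubgroup H → H = ⊥

/-- A *torsion* abelian group: every element has finite order. -/
def TorsionGroup : Prop := ∀ x : G, ∃ n : ℕ, 0 < n ∧ n • x = 0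

/-- A *torsion-free* abelian group. -/
def TorsionFreeGroup : Prop := ∀ x : G, ∀ n : ℕ, 0 < n → n • x = 0 → x = 0

/-- The `p`-primary component of `G`: elements of order a power of `p`. -/
def pComponent (p : ℕ) : AddSubgroup G where
  carrier := {x : G | ∃ n : ℕ, p ^ n • x = 0}
  zero_mem' := ⟨0, smul_zero _⟩
  add_mem' := by
    rintro a b ⟨m, hm⟩ ⟨n, hn⟩
    refine ⟨m + n, ?_⟩
    have h1 : p ^ (m + n) • a = 0 := by
      rw [pow_add, mul_comm, mul_smul, hm, smul_zero]
    have h2 : p ^ (m + n) • b = 0 := by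
      rw [pow_add, mul_smul, hn, smul_zero]
    rw [smul_add, h1, h2, add_zero]
  neg_mem' := by
    rintro a ⟨n, hn⟩
    exact ⟨n, by rw [smul_neg, hn, neg_zero]⟩

/-- The subgroup `(p^k G)[p]` of `G`. -/
def ulmSub (p k : ℕ) : AddSubgroup G := smulSub G (p ^ k) ⊓ torsionSub G p

/-- The Ulm quotient `(p^k G)[p] / (p^{k+1} G)[p]`. -/
abbrev UlmQuot (p k : ℕ) :=
  ↥(ulmSub G p k) ⧸ ((ulmSub G p (k + 1)).addSubgroupOf (ulmSub G p k))

theorem UlmQuot_nsmul (p k : ℕ) (x : UlmQuot G p k) : p • x = 0 := by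
  induction x using QuotientAddGroup.induction_on with
  | _ a =>
    have ha : p • a = (0 : ↥(ulmSub G p k)) := by
      ext
      exact a.2.2
    rw [← QuotientAddGroup.mk_nsmul, ha, QuotientAddGroup.mk_zero]

theorem torsionSub_nsmul (p : ℕ) (x : ↥(torsionSub G p)) : p • x = 0 := by
  ext
  exact x.2

/-- The `k`-th Ulm invariant of `G` at `p`: the dimension of
`(p^k G)[p] / (p^{k+1} G)[p]` over `ℤ/pℤ`, as a cardinal. -/
noncomputable def UlmInvariant (p k : ℕ) : Cardinal :=
  letI : Module (ZMod p) (UlmQuot G p k) := AddCommGroup.zmodModule (UlmQuot_nsmul G p k)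
  Module.rank (ZMod p) (UlmQuot G p k)

/-- `G` is `p`-*semi-standard* if all the finite Ulm invariants are finite. -/
def PSemiStandard (p : ℕ) : Prop := ∀ n : ℕ, UlmInvariant G p n < Cardinal.aleph0

/-- The `p`-rank of `G`: the dimension of `G[p]` over `ℤ/pℤ`, as a cardinal. -/
noncomputable def pRank (p : ℕ) : Cardinal :=
  letI : Module (ZMod p) ↥(torsionSub G p) := AddCommGroup.zmodModule (torsionSub_nsmul G p)
  Module.rank (ZMod p) ↥(torsionSub G p)

/-- The (torsion-free) rank of `G`: the dimension of `ℚ ⊗ G` over `ℚ`. -/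
noncomputable def rationalRank : Cardinal :=
  Module.rank ℚ (TensorProduct ℤ ℚ G)

/-- The maximal divisible subgroup of `G`. -/
def maxDivisible : AddSubgroup G := sSup {H : AddSubgroup G | IsDivisibleSubgroup H}

/-- The Prüfer `p`-group `ℤ(p^∞)`, realized as the `p`-primary component of `ℚ/ℤ`. -/
abbrev PruferGroup (p : ℕ) :=
  ↥(pComponent (ℚ ⧸ AddSubgroup.zmultiples (1 : ℚ)) p)

end Defs

/-- Kernels of surjective endomorphisms are superfluous subgroups. -/
def SmallKer (G : Type u) [AddCommGroup G] : Prop :=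
  ∀ φ : G →+ G, Surjective φ → ∀ K : AddSubgroup G,
    (∀ g : G, ∃ h, φ h = 0 ∧ g - h ∈ K) → ∀ g, g ∈ K

theorem smallKer_of_relHopf {G : Type u} [AddCommGroup G] (h : RelativelyHopfian G) :
    SmallKer G := by
  intro φ hφ K hK g
  have := h (G ⧸ K) (φ.prod (QuotientAddGroup.mk' K)) (by
    rintro ⟨a, b⟩
    obtain ⟨x, rfl⟩ := hφ a
    obtain ⟨y, rfl⟩ := QuotientAddGroup.mk'_surjective K b
    obtain ⟨t, ht, htK⟩ := hK (y - x)
    refine ⟨x + t, ?_⟩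
    ext
    · simp [ht]
    · simp only [AddMonoidHom.prod_apply]
      refine (QuotientAddGroup.eq (s := K)).2 ?_
      convert htK using 1
      abel)
  have h2 : (g : G ⧸ K) = ((0 : G) : G ⧸ K) := Subsingleton.elim _ _
  exact (QuotientAddGroup.eq_zero_iff g).1 h2

theorem mem_smulSub {G : Type u} [AddCommGroup G] {n : ℕ} {x : G} :
    x ∈ smulSub G n ↔ ∃ y, n • y = x := Iff.rfl

theorem mem_torsionSub {G : Type u} [AddCommGroup G] {n : ℕ} {x : G} :
    x ∈ torsionSub G n ↔ n • x = 0 := Iff.rfl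

theorem quot_nsmul {G V : Type u} [AddCommGroup G] [AddCommGroup V] {n : ℕ} {π : G →+ V}
    (hs : Surjective π) (hπ : ∀ g, π g = 0 ↔ ∃ y, n • y = g) (x : V) : n • x = 0 := by
  obtain ⟨y, rfl⟩ := hs x
  rw [← map_nsmul]
  exact (hπ _).2 ⟨y, rfl⟩

theorem exists_quot (G : Type u) [AddCommGroup G] (n : ℕ) :
    ∃ (V : Type u) (_ : AddCommGroup V) (_ : Module (ZMod n) V) (π : G →+ V), Surjective π ∧
      ∀ g, π g = 0 ↔ ∃ y, n • y = g :=
  ⟨G ⧸ smulSub G n, inferInstance,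
    AddCommGroup.zmodModule (quot_nsmul (π := QuotientAddGroup.mk' (smulSub G n))
      (QuotientAddGroup.mk'_surjective _) (fun g => QuotientAddGroup.eq_zero_iff g)),
    QuotientAddGroup.mk' _, QuotientAddGroup.mk'_surjective _,
    fun g => QuotientAddGroup.eq_zero_iff g⟩

theorem ker_le_smul {G : Type u} [AddCommGroup G] (h : SmallKer G) (p : ℕ) [Fact p.Prime]
    (φ : G →+ G) (hφ : Surjective φ) (x : G) (hx : φ x = 0) : ∃ y, p • y = x := by
  by_contra hcon
  obtain ⟨V, _, _, π, hs, hπ⟩ := exists_quot G p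
  have hne : π x ≠ 0 := by
    intro h0
    exact hcon ((hπ x).1 h0)
  have : ∃ l : V →ₗ[ZMod p] ZMod p, l (π x) ≠ 0 := by
    by_contra! hc
    exact hne ((Module.forall_dual_apply_eq_zero_iff (ZMod p) (π x)).1 hc)
  obtain ⟨l, hl⟩ := this
  let L : G →+ ZMod p := l.toAddMonoidHom.comp π
  have hL : L x ≠ 0 := hl
  refine hL (h φ hφ L.ker ?_ x)
  intro g
  refine ⟨(L g / L x).val • x, by simp [hx], ?_⟩
  rw [AddMonoidHom.mem_ker, map_sub, map_nsmul, nsmul_eq_mul, ZMod.natCast_val, ZMod.cast_id,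
    div_mul_cancel₀ _ hL, sub_self]

theorem relHopf_of_bounded (p : ℕ) (hp : p.Prime)
    (G : Type u) [AddCommGroup G] (hG : IsPAddGroup G p)
    (h : ∀ H : AddSubgroup G, Nonempty ((G ⧸ H) ≃+ G) →
        IsBoundedSubgroup H ∧ H ≤ pOmega G p) : RelativelyHopfian G := by
  intro A _ φ hφ
  let f : G →+ G := (AddMonoidHom.fst G A).comp φ
  have hf : Surjective f := fun g => by
    obtain ⟨x, hx⟩ := hφ (g, 0)
    exact ⟨x, by simp [f, hx]⟩
  obtain ⟨⟨n, hn, hb⟩, hle⟩ := h f.ker ⟨QuotientAddGroup.quotientKerEquivOfSurjective f hf⟩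
  obtain ⟨k, m, hm, rfl⟩ := Nat.exists_eq_pow_mul_and_not_dvd hn.ne' p hp.ne_one
  have hA : ∀ a : A, ∃ x ∈ f.ker, (φ x).2 = a := by
    intro a
    obtain ⟨x, hx⟩ := hφ (0, a)
    exact ⟨x, by simp [f, AddMonoidHom.mem_ker, hx], by simp [hx]⟩
  have hkill : ∀ a : A, p ^ k • a = 0 := by
    intro a
    obtain ⟨x, hx, rfl⟩ := hA a
    have h1 := hb x hx
    obtain ⟨j, hj⟩ := hG x
    have h2 : p ^ k • x = 0 := by
      have d1 := addOrderOf_dvd_of_nsmul_eq_zero h1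
      have d2 := addOrderOf_dvd_of_nsmul_eq_zero hj
      obtain ⟨i, -, hi⟩ := (Nat.dvd_prime_pow hp).1 d2
      apply addOrderOf_dvd_iff_nsmul_eq_zero.1
      refine Nat.Coprime.dvd_of_dvd_mul_right ?_ d1
      rw [hi]
      exact Nat.Coprime.pow_left _ ((Nat.Prime.coprime_iff_not_dvd hp).2 hm)
    rw [← Prod.smul_snd, ← map_nsmul, h2]; simp
  refine ⟨fun a b => ?_⟩
  suffices H : ∀ a : A, a = 0 by rw [H a, H b]
  intro a
  obtain ⟨x, hx, rfl⟩ := hA a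
  have := hle hx
  rw [pOmega, AddSubgroup.mem_iInf] at this
  obtain ⟨y, hy⟩ := mem_smulSub.1 (this k)
  rw [← hy, map_nsmul, Prod.smul_snd, hkill]

theorem exists_circle_char {A : Type u} [AddCommGroup A] (a : A) (ha : a ≠ 0) :
    ∃ c : A → Circle, (∀ x y, c (x + y) = c x * c y) ∧ c a ≠ 1 := by
  obtain ⟨c, hc⟩ := CharacterModule.exists_character_apply_ne_zero_of_ne_zero ha
  let j : AddCircle (1 : ℚ) →+ AddCircle (1 : ℝ) :=
    QuotientAddGroup.map _ _ (Rat.castHom ℝ).toAddMonoidHom (by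
      rintro _ ⟨z, rfl⟩
      exact ⟨z, by simp⟩)
  have hj : ∀ x, j x = 0 → x = 0 := by
    intro x
    induction x using QuotientAddGroup.induction_on with
    | _ q =>
    intro h
    have h' : ((q : ℝ) : AddCircle (1 : ℝ)) = 0 := h
    rw [AddCircle.coe_eq_zero_iff] at h'
    obtain ⟨n, hn⟩ := h'
    refine (AddCircle.coe_eq_zero_iff (1 : ℚ)).2 ⟨n, ?_⟩
    have : ((n : ℤ) : ℝ) = (q : ℝ) := by simpa using hn
    have h3 : (n : ℚ) = q := by exact_mod_cast this
    simpa using h3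
  refine ⟨fun x => (j (c x)).toCircle, fun x y => ?_, fun h => ?_⟩
  · simp only [map_add, AddCircle.toCircle_add]
  · apply hc
    apply hj
    apply AddCircle.injective_toCircle (T := 1) one_ne_zero
    exact h.trans AddCircle.toCircle_zero.symm

theorem circle_aux (p : ℕ) (hp : p.Prime) (z w : Circle) (m k : ℕ) (hw : w ^ (p ^ m) = 1)
    (hz : z ^ (p ^ k) = 1) (hzm : z ^ (p ^ m) ≠ 1) : ∃ i : ℕ, z ^ i = w := by
  obtain ⟨j, -, hj⟩ := (Nat.dvd_prime_pow hp).1 (orderOf_dvd_of_pow_eq_one hz)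
  have hmj : m ≤ j := by
    by_contra hcon
    apply hzm
    apply orderOf_dvd_iff_pow_eq_one.1
    rw [hj]
    exact pow_dvd_pow _ (by omega)
  have hw' : w ^ (p ^ j) = 1 := by
    rw [← Nat.add_sub_of_le hmj, pow_add, pow_mul, hw, one_pow]
  have hprim : IsPrimitiveRoot (z : ℂ) (p ^ j) := by
    rw [← hj]
    exact (IsPrimitiveRoot.orderOf z).map_of_injective (f := Circle.coeHom) Circle.coe_injective
  haveI : NeZero (p ^ j) := ⟨pow_ne_zero _ hp.ne_zero⟩
  obtain ⟨i, -, hi⟩ := hprim.eq_pow_of_pow_eq_one (ξ := (w : ℂ)) (by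
    rw [← Circle.coe_pow, hw', Circle.coe_one])
  refine ⟨i, ?_⟩
  apply Circle.coe_injective
  rw [Circle.coe_pow, hi]

theorem ker_bounded {G : Type u} [AddCommGroup G] (h : SmallKer G) (p : ℕ) (hp : p.Prime)
    (hG : IsPAddGroup G p) (φ : G →+ G) (hφ : Surjective φ) :
    ∃ n : ℕ, ∀ x, φ x = 0 → p ^ n • x = 0 := by
  classical
  let X : Set (G → Circle) := {c | ∀ x y, c (x + y) = c x * c y}
  have hXclosed : IsClosed X := by
    simp only [X, Set.ofPred_forall]
    refine isClosed_iInter fun x => isClosed_iInter fun y => ?_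
    exact isClosed_eq (by fun_prop) (by fun_prop)
  haveI : CompactSpace X := isCompact_iff_compactSpace.1 hXclosed.isCompact
  haveI : Nonempty X := ⟨⟨fun _ => 1, by intro x y; simp⟩⟩
  have X0 : ∀ c : X, c.1 0 = 1 := fun c => by
    have := c.2 0 0
    simpa using this
  have Xn : ∀ (c : X) (n : ℕ) x, c.1 (n • x) = c.1 x ^ n := fun c n x => by
    induction n with
    | zero => simp [X0]
    | succ n ih => rw [succ_nsmul, c.2, ih, pow_succ]
  let C : ℕ → Set X := fun n => {c | ∀ x, φ x = 0 → c.1 x ^ (p ^ n) = 1}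
  have hC : ∀ n, IsClosed (C n) := by
    intro n
    simp only [C, Set.ofPred_forall]
    refine isClosed_iInter fun x => isClosed_iInter fun y => ?_
    exact isClosed_eq (((continuous_apply x).comp continuous_subtype_val).pow _) continuous_const
  have hU : ⋃ n, C n = Set.univ := by
    rw [Set.eq_univ_iff_forall]
    intro c
    rw [Set.mem_iUnion]
    by_contra hcon
    push Not at hcon
    have hc1 : ∀ g, c.1 g = 1 := by
      let K : AddSubgroup G :=
        { carrier := {g | c.1 g = 1}
          zero_mem' := X0 c
          add_mem' := by
            intro a b ha hb
            change c.1 (a + b) = 1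
            rw [c.2, show c.1 a = 1 from ha, show c.1 b = 1 from hb, one_mul]
          neg_mem' := by
            intro a ha
            have := c.2 a (-a)
            rw [add_neg_cancel, X0, show c.1 a = 1 from ha, one_mul] at this
            exact this.symm }
      refine h φ hφ K ?_
      intro g
      obtain ⟨m, hm⟩ := hG g
      have := hcon m
      simp only [C, Set.mem_ofPred_eq] at this
      push Not at this
      obtain ⟨x, hx, hxm⟩ := this
      obtain ⟨k, hk⟩ := hG x
      obtain ⟨i, hi⟩ := circle_aux p hp (c.1 x) (c.1 g) m k (by rw [← Xn, hm, X0])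
        (by rw [← Xn, hk, X0]) hxm
      refine ⟨i • x, by simp [hx], ?_⟩
      change c.1 (g - i • x) = 1
      have h3 := c.2 (g - i • x) (i • x)
      rw [sub_add_cancel, Xn, hi] at h3
      exact (right_eq_mul.1 h3)
    exact hcon 0 (fun x _ => by rw [hc1, one_pow])
  obtain ⟨n, c0, hc0⟩ := nonempty_interior_of_iUnion_of_closed hC hU
  obtain ⟨U, hUo, hUeq⟩ := isOpen_induced_iff.1 (isOpen_interior (s := C n))
  have hc0U : c0.1 ∈ U := by
    have : c0 ∈ Subtype.val ⁻¹' U := by rw [hUeq]; exact hc0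
    exact this
  obtain ⟨I, u, hu, huU⟩ := isOpen_pi_iff.1 hUo c0.1 hc0U
  have hc0C : c0 ∈ C n := interior_subset hc0
  have key : ∀ e : X, (∀ x ∈ I, e.1 x = 1) → e ∈ C n := by
    intro e he x hx
    let d : X := ⟨fun x => c0.1 x * e.1 x, fun x y => by
      simp only [c0.2 x y, e.2 x y]; exact mul_mul_mul_comm _ _ _ _⟩
    have hd : d ∈ C n := by
      apply interior_subset
      rw [← hUeq]
      apply huU
      intro a ha
      change c0.1 a * e.1 a ∈ u a
      rw [he a ha, mul_one]
      exact (hu a ha).2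
    have h1 := hd x hx
    change (c0.1 x * e.1 x) ^ (p ^ n) = 1 at h1
    rw [mul_pow, hc0C x hx, one_mul] at h1
    exact h1
  choose o ho using hG
  refine ⟨I.sup o + n, fun x hx => ?_⟩
  have hmem : p ^ n • x ∈ AddSubgroup.closure (I : Set G) := by
    by_contra hcon
    obtain ⟨c, hc, hcne⟩ := exists_circle_char
      ((p ^ n • x : G) : G ⧸ AddSubgroup.closure (I : Set G))
      (fun h0 => hcon ((QuotientAddGroup.eq_zero_iff _).1 h0))
    let e : X := ⟨fun y => c (y : G ⧸ AddSubgroup.closure (I : Set G)), fun x y => hc (x : G ⧸ AddSubgroup.closure (I : Set G)) y⟩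
    apply hcne
    change e.1 (p ^ n • x) = 1
    rw [Xn]
    refine key e ?_ x hx
    intro y hy
    have h2 : (y : G ⧸ AddSubgroup.closure (I : Set G)) = ((0 : G) : _) :=
      (QuotientAddGroup.eq_zero_iff _).2 (AddSubgroup.subset_closure hy)
    change c (y : G ⧸ AddSubgroup.closure (I : Set G)) = 1
    rw [h2]
    exact X0 e
  have hle : AddSubgroup.closure (I : Set G) ≤ torsionSub G (p ^ (I.sup o)) := by
    rw [AddSubgroup.closure_le]
    intro y hy
    change p ^ _ • y = 0
    rw [← Nat.sub_add_cancel (Finset.le_sup (f := o) hy), pow_add, mul_smul, ho, smul_zero]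
  rw [pow_add, mul_smul]
  exact hle hmem

theorem dvd_aux (p : ℕ) (hp : p.Prime) (n j : ℕ) (hj : j ≤ n) (b : ZMod (p ^ n))
    (h : ((p ^ (n - j) : ℕ) : ZMod (p ^ n)) * b = 0) :
    ∃ c : ZMod (p ^ n), ((p ^ j : ℕ) : ZMod (p ^ n)) * c = b := by
  haveI : NeZero (p ^ n) := ⟨pow_ne_zero _ hp.ne_zero⟩
  obtain ⟨b, rfl⟩ := ZMod.natCast_zmod_surjective b
  rw [← Nat.cast_mul, ZMod.natCast_eq_zero_iff] at h
  have h2 : p ^ j ∣ b := by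
    have h3 : p ^ (n - j) * p ^ j ∣ p ^ (n - j) * b := by
      rwa [← pow_add, Nat.sub_add_cancel hj]
    exact Nat.dvd_of_mul_dvd_mul_left (pow_pos hp.pos _) h3
  obtain ⟨c, rfl⟩ := h2
  exact ⟨c, by push_cast; rfl⟩

theorem ideal_aux (p : ℕ) (hp : p.Prime) (n : ℕ) (I : Ideal (ZMod (p ^ n))) :
    ∃ j ≤ n, I = Ideal.span {((p ^ j : ℕ) : ZMod (p ^ n))} := by
  obtain ⟨J, hJ⟩ : ∃ J : Ideal ℤ, J = I.comap (Int.castRingHom (ZMod (p ^ n))) := ⟨_, rfl⟩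
  have hI : J.map (Int.castRingHom (ZMod (p ^ n))) = I := by
    rw [hJ]
    exact Ideal.map_comap_of_surjective _ (ZMod.intCast_surjective) I
  obtain ⟨a, ha⟩ := (IsPrincipalIdealRing.principal J).principal
  have hmem : ((p ^ n : ℕ) : ℤ) ∈ J := by
    rw [hJ, Ideal.mem_comap]
    have : (Int.castRingHom (ZMod (p ^ n))) ((p ^ n : ℕ) : ℤ) = 0 := by
      rw [map_natCast, ZMod.natCast_self]
    rw [this]; exact I.zero_mem
  rw [ha] at hmem
  have hdvd : a ∣ ((p ^ n : ℕ) : ℤ) := Ideal.mem_span_singleton.1 hmem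
  have hdvd' : a.natAbs ∣ p ^ n := Int.natAbs_dvd_natAbs.2 hdvd
  obtain ⟨j, hj, haj⟩ := (Nat.dvd_prime_pow hp).1 hdvd'
  refine ⟨j, hj, ?_⟩
  have : J = Ideal.span {((p ^ j : ℕ) : ℤ)} := by
    rw [ha, ← haj]
    exact (Int.span_natAbs a).symm
  rw [← hI, this, Ideal.map_span, Set.image_singleton, map_natCast]

theorem baer_finsupp (p : ℕ) (hp : p.Prime) (n : ℕ) :
    Module.Baer (ZMod (p ^ n)) (ℕ →₀ ZMod (p ^ n)) := by
  intro I g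
  obtain ⟨j, hj, hI⟩ := ideal_aux p hp n I
  obtain ⟨t, ht⟩ : ∃ t : ZMod (p ^ n), t = ((p ^ j : ℕ) : ZMod (p ^ n)) := ⟨_, rfl⟩
  rw [← ht] at hI
  subst hI
  have htm : t ∈ Ideal.span {t} := Ideal.mem_span_singleton_self t
  have hb : ∀ i, ∃ c, t * c = g ⟨t, htm⟩ i := by
    intro i
    have hda := dvd_aux p hp n j hj (g ⟨t, htm⟩ i)
    rw [← ht] at hda
    apply hda
    have h1 : ((p ^ (n - j) : ℕ) : ZMod (p ^ n)) • (⟨t, htm⟩ : Ideal.span {t}) = 0 := by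
      ext
      change ((p ^ (n - j) : ℕ) : ZMod (p ^ n)) * t = 0
      rw [ht, ← Nat.cast_mul, ← pow_add, Nat.sub_add_cancel hj, ZMod.natCast_self]
    have h2 := congrArg g h1
    rw [map_smul, map_zero] at h2
    exact DFunLike.congr_fun h2 i
  choose c hc using hb
  let b : ℕ →₀ ZMod (p ^ n) :=
    Finsupp.onFinset (g ⟨t, htm⟩).support
      (fun i => if i ∈ (g ⟨t, htm⟩).support then c i else 0) (by
        intro i hi
        by_contra hcon
        simp [hcon] at hi)
  have hbt : t • b = g ⟨t, htm⟩ := by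
    ext i
    by_cases hi : i ∈ (g ⟨t, htm⟩).support
    · simp only [Finsupp.smul_apply, b, Finsupp.onFinset_apply, if_pos hi, smul_eq_mul, hc]
    · simp only [Finsupp.smul_apply, b, Finsupp.onFinset_apply, if_neg hi, smul_zero]
      exact (Finsupp.notMem_support_iff.1 hi).symm
  refine ⟨LinearMap.toSpanSingleton _ _ b, ?_⟩
  intro x hx
  obtain ⟨a, rfl⟩ := Ideal.mem_span_singleton'.1 hx
  rw [LinearMap.toSpanSingleton_apply, mul_smul, hbt, ← map_smul]
  rfl

/-- An infinite family of elements of order `p^n`, independent modulo lower torsion and `pG`,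
yields a surjective endomorphism whose kernel contains the zeroth element. -/
theorem exists_shift {G : Type u} [AddCommGroup G] (p : ℕ) (hp : p.Prime) (k : ℕ) (y : ℕ → G)
    (hy : ∀ i, p ^ (k + 1) • y i = 0)
    (hind : ∀ a : ℕ →₀ ℤ, (∃ t g : G, p ^ k • t = 0 ∧ (a.sum fun i c => c • y i) = t + p • g) →
      ∀ i, (p : ℤ) ∣ a i) :
    ∃ φ : G →+ G, Surjective φ ∧ φ (y 0) = 0 := by
  classical
  set n := k + 1 with hn
  obtain ⟨V, _, _, q, hs, hq⟩ := exists_quot G (p ^ n)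
  let e : ℕ → (ZMod (p ^ n) →+ G) := fun i =>
    ZMod.lift (p ^ n) ⟨(zmultiplesHom G) (y i), by
      rw [zmultiplesHom_apply, natCast_zsmul]; exact hy i⟩
  have he : ∀ i (c : ℤ), e i (c : ZMod (p ^ n)) = c • y i := by
    intro i c
    simp [e, zmultiplesHom_apply]
  let f : (ℕ →₀ ZMod (p ^ n)) →+ G := Finsupp.liftAddHom e
  let F : (ℕ →₀ ZMod (p ^ n)) →ₗ[ZMod (p ^ n)] V :=
    (q.comp f).toZModLinearMap (p ^ n)
  have hfa : ∀ a : ℕ →₀ ℤ,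
      f (a.mapRange (Int.cast : ℤ → ZMod (p ^ n)) Int.cast_zero) = a.sum fun i c => c • y i := by
    intro a
    simp only [f, Finsupp.liftAddHom_apply]
    rw [Finsupp.sum_mapRange_index (by intro i; exact map_zero _)]
    exact Finsupp.sum_congr fun i _ => he i _
  have hFinj : Injective (⇑F) := by
    rw [injective_iff_map_eq_zero]
    intro b hb
    obtain ⟨a, rfl⟩ := Finsupp.mapRange_surjective (Int.cast : ℤ → ZMod (p ^ n)) Int.cast_zero
      ZMod.intCast_surjective b
    have h1 : f (a.mapRange (Int.cast : ℤ → ZMod (p ^ n)) Int.cast_zero) = _ :=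
      hfa a
    obtain ⟨g, hg⟩ := (hq _).1 hb
    rw [h1] at hg
    have hdiv : ∀ j ≤ n, ∃ a' : ℕ →₀ ℤ, a = ((p ^ j : ℕ) : ℤ) • a' := by
      intro j
      induction j with
      | zero => intro _; exact ⟨a, by simp⟩
      | succ j ih =>
        intro hj
        obtain ⟨a', ha'⟩ := ih (by omega)
        have hs : (a.sum fun i c => c • y i) = p ^ j • (a'.sum fun i c => c • y i) := by
          rw [ha', Finsupp.sum_smul_index (by intro i; exact zero_smul _ _), Finsupp.smul_sum]
          refine Finsupp.sum_congr fun i _ => ?_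
          rw [mul_smul, natCast_zsmul]
        have hd := hind a' ⟨(a'.sum fun i c => c • y i) - p ^ (n - j) • g, p ^ (k - j) • g, ?_, ?_⟩
        · choose a'' ha'' using hd
          let a3 : ℕ →₀ ℤ := Finsupp.onFinset a'.support
            (fun i => a' i / p) (by
              intro i hi
              rw [Finsupp.mem_support_iff]
              rintro h0
              simp [h0] at hi)
          refine ⟨a3, ?_⟩
          ext i
          have := Int.mul_ediv_cancel' (Dvd.intro _ (ha'' i).symm : (p : ℤ) ∣ a' i)
          rw [ha']
          simp only [Finsupp.smul_apply, smul_eq_mul, a3, Finsupp.onFinset_apply]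
          push_cast
          rw [pow_succ, mul_assoc, this]
        · have h5 : p ^ j • ((a'.sum fun i c => c • y i) - p ^ (n - j) • g) = 0 := by
            rw [smul_sub, ← hs, ← hg, ← mul_smul, ← pow_add, Nat.add_sub_of_le (by omega), sub_self]
          rw [← Nat.sub_add_cancel (show j ≤ k by omega), pow_add, mul_smul, h5, smul_zero]
        · rw [← mul_smul, ← pow_succ', show k - j + 1 = n - j by omega, sub_add_cancel]
    obtain ⟨a', ha'⟩ := hdiv n le_rfl
    ext i
    rw [ha']
    simp only [Finsupp.mapRange_apply, Finsupp.smul_apply, smul_eq_mul, Finsupp.coe_zero,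
      Pi.zero_apply]
    rw [Int.cast_mul, Int.cast_natCast, ZMod.natCast_self, zero_mul]
  obtain ⟨r', hr'⟩ := (baer_finsupp p hp n).extension_property F hFinj LinearMap.id
  let r : G →+ (ℕ →₀ ZMod (p ^ n)) := r'.toAddMonoidHom.comp q
  have hr : ∀ b, r (f b) = b := fun b => DFunLike.congr_fun hr' b
  let S : (ℕ →₀ ZMod (p ^ n)) →+ (ℕ →₀ ZMod (p ^ n)) :=
    Finsupp.comapDomain.addMonoidHom Nat.succ_injective
  have hS : Surjective S := by
    intro b
    refine ⟨Finsupp.mapDomain Nat.succ b, ?_⟩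
    ext i
    exact Finsupp.mapDomain_apply Nat.succ_injective b i
  refine ⟨AddMonoidHom.id G - f.comp r + f.comp (S.comp r), ?_, ?_⟩
  · intro g
    obtain ⟨b, hb⟩ := hS (r g)
    refine ⟨g - f (r g) + f b, ?_⟩
    simp only [AddMonoidHom.add_apply, AddMonoidHom.sub_apply, AddMonoidHom.id_apply,
      AddMonoidHom.comp_apply, map_add, map_sub, hr, hb, sub_self, zero_add]
    abel
  · have hy0 : y 0 = f (Finsupp.single 0 1) := by
      simp only [f, Finsupp.liftAddHom_apply_single]
      have := he 0 1
      simpa using this.symm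
    have hS0 : S (Finsupp.single 0 1) = 0 := by
      ext i
      change (Finsupp.single 0 (1 : ZMod (p ^ n))) (Nat.succ i) = 0
      simp
    simp only [AddMonoidHom.add_apply, AddMonoidHom.sub_apply, AddMonoidHom.id_apply,
      AddMonoidHom.comp_apply]
    rw [hy0, hr, hS0, map_zero, sub_self, add_zero]

theorem layer_finite {G V : Type u} [AddCommGroup G] [AddCommGroup V] (h : SmallKer G)
    (p : ℕ) [Module (ZMod p) V] [hp : Fact p.Prime] (π : G →+ V) (hs : Surjective π)
    (hπ : ∀ g, π g = 0 ↔ ∃ y, p • y = g) :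
    ∀ k, Finite ((torsionSub G (p ^ k)).map π) := by
  classical
  let L : ℕ → Submodule (ZMod p) V := fun k =>
    AddSubgroup.toZModSubmodule p ((torsionSub G (p ^ k)).map π)
  suffices H : ∀ k, (L k).FG by
    intro k
    haveI : Module.Finite (ZMod p) (L k) := Module.Finite.iff_fg.2 (H k)
    exact (Module.finite_of_finite (ZMod p) : Finite (L k))
  have hL : ∀ k v, v ∈ L k ↔ ∃ t : G, p ^ k • t = 0 ∧ π t = v :=
    fun k v => by
      change v ∈ (torsionSub G (p ^ k)).map π ↔ _
      exact Iff.rfl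
  intro k
  induction k with
  | zero =>
    have : L 0 = ⊥ := by
      rw [eq_bot_iff]
      intro v hv
      obtain ⟨t, ht, rfl⟩ := (hL _ _).1 hv
      simp at ht
      simp [ht]
    rw [this]; exact Submodule.fg_bot
  | succ k ih =>
    refine Submodule.fg_of_fg_map_of_fg_inf_ker (L k).mkQ ?_ ?_
    · by_contra hcon
      let W := (L (k + 1)).map (L k).mkQ
      let b := Module.Basis.ofVectorSpace (ZMod p) W
      have hinf : Infinite (Module.Basis.ofVectorSpaceIndex (ZMod p) W) := by
        by_contra hfin
        rw [not_infinite_iff_finite] at hfin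
        exact hcon (Module.Finite.iff_fg.1 (Module.Finite.of_basis b))
      let w : ℕ → W := fun i => b (Infinite.natEmbedding _ i)
      have hw : LinearIndependent (ZMod p) w :=
        b.linearIndependent.comp _ (Infinite.natEmbedding _).injective
      have hw' : LinearIndependent (ZMod p) (fun i => (w i : V ⧸ L k)) :=
        hw.map' W.subtype (Submodule.ker_subtype W)
      have hlift : ∀ i, ∃ t : G, p ^ (k + 1) • t = 0 ∧
          (L k).mkQ (π t) = w i := by
        intro i
        obtain ⟨v, hv, hvw⟩ := (w i).2
        obtain ⟨t, ht, rfl⟩ := (hL _ _).1 hv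
        exact ⟨t, ht, hvw⟩
      choose y hy hyw using hlift
      let Q : G →+ (V ⧸ L k) := (L k).mkQ.toAddMonoidHom.comp π
      have hQ : ∀ i, Q (y i) = w i := hyw
      have hQt : ∀ t, p ^ k • t = 0 → Q t = 0 := by
        intro t ht
        exact (Submodule.Quotient.mk_eq_zero _).2 ((hL _ _).2 ⟨t, ht, rfl⟩)
      have hQp : ∀ g, Q (p • g) = 0 := by
        intro g
        have : π (p • g) = 0 :=
          (hπ _).2 ⟨g, rfl⟩
        change (L k).mkQ (π (p • g)) = 0
        rw [this, map_zero]
      obtain ⟨φ, hφ, hφ0⟩ := exists_shift p hp.out k y hy (by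
        rintro a ⟨t, g, ht, hsum⟩ i
        have h1 := congrArg Q hsum
        rw [map_add, hQt t ht, hQp, add_zero, map_finsuppSum] at h1
        have h2 := (linearIndependent_iff.1 hw')
          (a.mapRange (Int.cast : ℤ → ZMod p) Int.cast_zero) (by
            rw [Finsupp.linearCombination_apply, Finsupp.sum_mapRange_index (by simp), ← h1]
            refine Finsupp.sum_congr fun i _ => ?_
            rw [map_zsmul, hQ, Int.cast_smul_eq_zsmul])
        have h3 := DFunLike.congr_fun h2 i
        exact (ZMod.intCast_zmod_eq_zero_iff_dvd _ _).1 h3)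
      obtain ⟨z, hz⟩ := ker_le_smul h p φ hφ (y 0) hφ0
      apply hw'.ne_zero 0
      rw [← hQ, ← hz, hQp]
    · have : L (k + 1) ⊓ (L k).mkQ.ker = L k := by
        rw [Submodule.ker_mkQ, inf_eq_right]
        intro v hv
        obtain ⟨t, ht, rfl⟩ := (hL _ _).1 hv
        exact (hL _ _).2 ⟨t, by rw [pow_succ', mul_smul, ht, smul_zero], rfl⟩
      rw [this]; exact ih

theorem ker_le_pow {G : Type u} [AddCommGroup G] (h : SmallKer G) (p : ℕ) [hp : Fact p.Prime]
    (φ : G →+ G) (hφ : Surjective φ) (n : ℕ) : ∀ x, φ x = 0 → ∃ y, p ^ n • y = x := by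
  induction n with
  | zero => intro x _; exact ⟨x, by simp⟩
  | succ n ih =>
    intro x hx
    obtain ⟨y, rfl⟩ := ih x hx
    let π := QuotientAddGroup.mk' (smulSub G p)
    let Y := (torsionSub G (p ^ n)).map π
    have hπ : ∀ g, π g = 0 ↔ ∃ y, p • y = g := fun g => QuotientAddGroup.eq_zero_iff g
    have hsurj : Surjective π := QuotientAddGroup.mk'_surjective _
    letI := AddCommGroup.zmodModule (quot_nsmul hsurj hπ)
    haveI := layer_finite h p π hsurj hπ n
    let T : (G ⧸ smulSub G p) →+ (G ⧸ smulSub G p) := QuotientAddGroup.map _ _ φ (by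
      rintro _ ⟨g, rfl⟩
      exact ⟨φ g, (map_nsmul φ p g).symm⟩)
    have hT : ∀ g, T (π g) = π (φ g) := fun g => rfl
    have hTinj0 : ∀ g, T (π g) = 0 → π g = 0 := by
      intro g hg
      rw [hT, hπ] at hg
      obtain ⟨z, hz⟩ := hg
      obtain ⟨w, rfl⟩ := hφ z
      obtain ⟨v, hv⟩ := ker_le_smul h p φ hφ (g - p • w) (by rw [map_sub, map_nsmul, hz, sub_self])
      exact (hπ g).2 ⟨v + w, by rw [smul_add, hv, sub_add_cancel]⟩
    have hTinj : Injective T := by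
      rw [injective_iff_map_eq_zero]
      intro v
      obtain ⟨g, rfl⟩ := QuotientAddGroup.mk'_surjective _ v
      exact hTinj0 g
    have hmaps : ∀ v : Y, T v ∈ Y := by
      rintro ⟨v, t, ht, rfl⟩
      exact ⟨φ t, by
        change p ^ n • φ t = 0
        rw [← map_nsmul, show p ^ n • t = 0 from ht, map_zero], rfl⟩
    let T' : Y → Y := fun v => ⟨T v, hmaps v⟩
    have hT'inj : Injective T' := fun a b hab => Subtype.ext (hTinj (congrArg Subtype.val hab))
    obtain ⟨⟨v, t, ht, rfl⟩, hv⟩ := Finite.surjective_of_injective hT'inj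
      ⟨π (φ y), φ y, by change p ^ n • φ y = 0; rw [← map_nsmul, hx], rfl⟩
    have h1 : T (π t) = T (π y) := congrArg Subtype.val hv
    have h2 : π (y - t) = 0 := by rw [map_sub, hTinj h1, sub_self]
    obtain ⟨g, hg⟩ := (hπ _).1 h2
    refine ⟨g, ?_⟩
    rw [pow_succ, mul_smul, hg, smul_sub, show p ^ n • t = 0 from ht, sub_zero]

/-- A `p`-group `G` is relatively Hopfian iff every subgroup `H`
with `G/H ≅ G` is a bounded subgroup of `p^ω G`. -/
theorem relativelyHopfian_iff_bounded_subgroup_of_pOmega (p : ℕ) (hp : p.Prime)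
    (G : Type u) [AddCommGroup G] (hG : IsPAddGroup G p) :
    RelativelyHopfian G ↔
      ∀ H : AddSubgroup G, Nonempty ((G ⧸ H) ≃+ G) →
        IsBoundedSubgroup H ∧ H ≤ pOmega G p := by
  refine ⟨?_, relHopf_of_bounded p hp G hG⟩
  rintro h H ⟨e⟩
  haveI : Fact p.Prime := ⟨hp⟩
  have hs := smallKer_of_relHopf h
  let φ : G →+ G := e.toAddMonoidHom.comp (QuotientAddGroup.mk' H)
  have hφ : Surjective φ := e.surjective.comp (QuotientAddGroup.mk'_surjective H)
  have hker : ∀ x ∈ H, φ x = 0 := by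
    intro x hx
    have : QuotientAddGroup.mk' H x = 0 := (QuotientAddGroup.eq_zero_iff x).2 hx
    change e (QuotientAddGroup.mk' H x) = 0
    rw [this, map_zero]
  constructor
  · obtain ⟨n, hn⟩ := ker_bounded hs p hp hG φ hφ
    exact ⟨p ^ n, pow_pos hp.pos _, fun x hx => hn x (hker x hx)⟩
  · intro x hx
    rw [pOmega, AddSubgroup.mem_iInf]
    exact fun n => ker_le_pow hs p φ hφ n x (hker x hx)
end

section
/- Let p be a prime and G an abelian p-group such that p^ω G is Hopfian (in particular, this covers the cases where p^ω G is finite or G is separable). Then G is relatively Hopfian if and only if G is Hopfian. -/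
open Function

universe u

open Polynomial in
/-- A bounded homogeneous subgroup meeting `mG` trivially has a complement. -/
theorem exists_compl_aux (p : ℕ) (hp : p.Prime) (i : ℕ) {G : Type u} [AddCommGroup G]
    (T : Submodule ℤ G)
    (h1 : ∀ x ∈ T, ∀ h : G, x = p ^ (i + 1) • h → x = 0)
    (h2 : ∀ x ∈ T, p ^ i • x = 0 → ∃ y ∈ T, x = p • y) :
    ∃ N : Submodule ℤ G, IsCompl T N := by
  let N0 : Submodule ℤ G := LinearMap.range ((nsmulHom G (p ^ (i + 1))).toIntLinearMap)
  have hN0 : ∀ x : G, p ^ (i + 1) • x ∈ N0 := fun x => ⟨x, rfl⟩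
  obtain ⟨N, hN0N, hN⟩ := zorn_le_nonempty₀ {S : Submodule ℤ G | Disjoint T S} (by
    intro c hc hchain y hy
    refine ⟨sSup c, ?_, fun z hz => le_sSup hz⟩
    rw [Set.mem_setOf_eq, Submodule.disjoint_def]
    intro x hxT hx
    rw [Submodule.mem_sSup_of_directed ⟨y, hy⟩ hchain.directedOn] at hx
    obtain ⟨S, hS, hxS⟩ := hx
    exact Submodule.disjoint_def.1 (hc hS) x hxT hxS) N0 (by
    rw [Set.mem_setOf_eq, Submodule.disjoint_def]
    rintro x hxT ⟨h, rfl⟩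
    exact h1 _ hxT h rfl)
  have hdisj : Disjoint T N := hN.prop
  refine ⟨N, hdisj, ?_⟩
  rw [codisjoint_iff, eq_top_iff]
  have step : ∀ g : G, p • g ∈ T ⊔ N → g ∈ T ⊔ N := by
    intro g hg
    obtain ⟨τ, hτ, n, hn, hsum⟩ := Submodule.mem_sup.1 hg
    have hz : p ^ i • τ = 0 := by
      apply Submodule.disjoint_def.1 hdisj
      · exact T.smul_of_tower_mem _ hτ
      · have : p ^ i • τ = p ^ (i + 1) • g - p ^ i • n := by
          rw [pow_succ, mul_smul, ← hsum, smul_add]; abel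
        rw [this]
        exact N.sub_mem (hN0N (hN0 g)) (N.smul_of_tower_mem _ hn)
    obtain ⟨τ', hτ', rfl⟩ := h2 τ hτ hz
    have hpg : p • (g - τ') ∈ N := by
      have : p • (g - τ') = n := by rw [smul_sub, ← hsum]; abel
      rwa [this]
    suffices hs : g - τ' ∈ T ⊔ N by
      have := (T ⊔ N).add_mem hs (Submodule.mem_sup_left hτ')
      simpa using this
    generalize g - τ' = w at hpg
    by_contra hw
    have hnd : ¬ Disjoint T (N ⊔ Submodule.span ℤ {w}) := by
      intro hd
      have := hN.le_of_ge (y := N ⊔ Submodule.span ℤ {w}) hd le_sup_left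
      exact hw (Submodule.mem_sup_right
        (this (Submodule.mem_sup_right (Submodule.mem_span_singleton_self w))))
    apply hnd
    rw [Submodule.disjoint_def]
    intro x hxT hx
    obtain ⟨n', hn', v, hv, hsum'⟩ := Submodule.mem_sup.1 hx
    obtain ⟨a, rfl⟩ := Submodule.mem_span_singleton.1 hv
    by_cases hpa : (p : ℤ) ∣ a
    · obtain ⟨b, rfl⟩ := hpa
      apply Submodule.disjoint_def.1 hdisj x hxT
      rw [← hsum', mul_comm, mul_smul, natCast_zsmul]
      exact N.add_mem hn' (N.smul_mem _ hpg)
    · exfalso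
      apply hw
      have hcop : IsCoprime (p : ℤ) a :=
        (Nat.prime_iff_prime_int.1 hp).coprime_iff_not_dvd.2 hpa
      obtain ⟨c, d, hcd⟩ := hcop
      have hw' : w = c • (p • w) + d • (a • w) := by
        rw [← natCast_zsmul, smul_smul, smul_smul, ← add_smul, hcd, one_smul]
      have haw : a • w = x - n' := by rw [← hsum']; abel
      rw [hw', haw]
      refine (T ⊔ N).add_mem (Submodule.mem_sup_right (N.smul_mem _ hpg))
        ((T ⊔ N).smul_mem _ ((T ⊔ N).sub_mem (Submodule.mem_sup_left hxT)
          (Submodule.mem_sup_right hn')))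
  have steps : ∀ k : ℕ, ∀ g : G, p ^ k • g ∈ T ⊔ N → g ∈ T ⊔ N := by
    intro k
    induction k with
    | zero => intro g hg; simpa using hg
    | succ k ih =>
      intro g hg
      exact step g (ih _ (by rwa [smul_smul, ← pow_succ]))
  intro g _
  exact steps (i + 1) g (Submodule.mem_sup_right (hN0N (hN0 g)))

theorem exists_functional_aux (p : ℕ) (hp : p.Prime) {W : Type u} [AddCommGroup W]
    (hW : ∀ w : W, p • w = 0) (v : W) (hv : v ≠ 0) : ∃ f : W →+ ZMod p, f v ≠ 0 := by
  have : Fact p.Prime := ⟨hp⟩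
  let _ : Module (ZMod p) W := AddCommGroup.zmodModule (n := p) hW
  by_contra hall
  push Not at hall
  exact hv ((Module.forall_dual_apply_eq_zero_iff (ZMod p) v).1
    fun f => hall f.toAddMonoidHom)

theorem ker_le_aux (p : ℕ) (hp : p.Prime) {G : Type u} [AddCommGroup G]
    (hR : RelativelyHopfian G) (σ : G →+ G) (hσ : Surjective σ) (x : G) (hx : σ x = 0) :
    ∃ y, x = p • y := by
  by_contra hno
  have : Fact p.Prime := ⟨hp⟩
  let v : G ⧸ smulSub G p := (QuotientAddGroup.mk x : G ⧸ smulSub G p)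
  have hv : v ≠ 0 := by
    intro hv
    obtain ⟨y, hy⟩ := (QuotientAddGroup.eq_zero_iff x).1 hv
    exact hno ⟨y, hy.symm⟩
  have hd := exists_functional_aux p hp (W := G ⧸ smulSub G p) (by
    intro v
    induction v using QuotientAddGroup.induction_on with
    | _ a =>
      rw [← QuotientAddGroup.mk_nsmul, QuotientAddGroup.eq_zero_iff]
      exact ⟨a, rfl⟩) v hv
  obtain ⟨f, hf⟩ := hd
  let ψ : G →+ ZMod p := f.comp (QuotientAddGroup.mk' (smulSub G p))
  have hψx : ψ x ≠ 0 := hf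
  have hsub := hR (ULift.{u} (ZMod p))
    (σ.prod ((AddEquiv.ulift (α := ZMod p)).symm.toAddMonoidHom.comp ψ)) (by
      rintro ⟨a, ⟨c⟩⟩
      obtain ⟨y, hy⟩ := hσ a
      refine ⟨y + ((c - ψ y) / ψ x).val • x, ?_⟩
      refine Prod.ext ?_ ?_
      · simp [hy, hx]
      · apply ULift.ext
        change ψ (y + ((c - ψ y) / ψ x).val • x) = c
        rw [map_add, map_nsmul, nsmul_eq_mul, ZMod.natCast_val, ZMod.cast_id,
          div_mul_cancel₀ _ hψx]
        abel)
  have h01 : (ULift.up 0 : ULift.{u} (ZMod p)) = ULift.up 1 := Subsingleton.elim _ _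
  exact zero_ne_one (congrArg ULift.down h01)

/-- `z ∈ G[p^i] + pG`. -/
def InU (p i : ℕ) {G : Type u} [AddCommGroup G] (z : G) : Prop :=
  ∃ a b : G, z = a + p • b ∧ p ^ i • a = 0

theorem InU.sub {p i : ℕ} {G : Type u} [AddCommGroup G] {z w : G}
    (hz : InU p i z) (hw : InU p i w) : InU p i (z - w) := by
  obtain ⟨a, b, rfl, h⟩ := hz
  obtain ⟨c, d, rfl, h'⟩ := hw
  exact ⟨a - c, b - d, by rw [smul_sub]; abel, by rw [smul_sub, h, h', sub_zero]⟩

theorem InU.zsmul {p i : ℕ} {G : Type u} [AddCommGroup G] {z : G}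
    (hz : InU p i z) (c : ℤ) : InU p i (c • z) := by
  obtain ⟨a, b, rfl, h⟩ := hz
  exact ⟨c • a, c • b, by rw [smul_add, smul_comm c p b],
    by rw [smul_comm, h, smul_zero]⟩

theorem InU.of_smul {p i : ℕ} {G : Type u} [AddCommGroup G] (z : G) : InU p i (p • z) :=
  ⟨0, z, by simp, by simp⟩

theorem InU.of_zero {p i : ℕ} {G : Type u} [AddCommGroup G] {z : G} (h : p ^ i • z = 0) :
    InU p i z := ⟨z, 0, by simp, h⟩

theorem InU.succ {p i : ℕ} {G : Type u} [AddCommGroup G] {z : G} (h : InU p i z) :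
    InU p (i + 1) z := by
  obtain ⟨a, b, h1, h2⟩ := h
  exact ⟨a, b, h1, by rw [pow_succ', mul_smul, h2, smul_zero]⟩

/-- `p^i z ∈ p^(i+1) G` implies `z ∈ G[p^i] + pG`. -/
theorem InU.of_pow {p i : ℕ} {G : Type u} [AddCommGroup G] {z y : G}
    (h : p ^ i • z = p ^ (i + 1) • y) : InU p i z :=
  ⟨z - p • y, y, by abel, by rw [smul_sub, h, pow_succ, mul_smul, sub_self]⟩

open Polynomial in
theorem step_aux (p : ℕ) (hp : p.Prime) {G : Type u} [AddCommGroup G]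
    (hR : RelativelyHopfian G) (φ : G →+ G) (hφ : Surjective φ) (i : ℕ)
    (ih : ∀ z, InU p i (φ z) → InU p i z) (z : G) (hz : InU p (i + 1) (φ z)) :
    InU p (i + 1) z := by
  by_contra hcon
  obtain ⟨t, b, hzt, ht⟩ := hz
  obtain ⟨b', rfl⟩ := hφ b
  obtain ⟨g, hg⟩ : ∃ g, g = z - p • b' := ⟨_, rfl⟩
  have hgt : φ g = t := by rw [hg, map_sub, map_nsmul, hzt]; abel
  have hgU : ¬ InU p (i + 1) g := by
    intro h
    apply hcon
    have := h.sub (InU.of_smul (p := p) (i := i + 1) (-b'))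
    rw [hg] at this
    simpa using this
  let Φ : Module.End ℤ G := φ.toIntLinearMap
  let ev : ℤ[X] →ₗ[ℤ] G := (LinearMap.applyₗ t).comp (aeval Φ).toLinearMap
  have evX : ∀ q : ℤ[X], ev (X * q) = φ (ev q) := by
    intro q
    change (aeval Φ (X * q)) t = φ ((aeval Φ q) t)
    rw [map_mul, aeval_X]
    rfl
  have evC : ∀ a : ℤ, ev (C a) = a • t := by
    intro a
    change (aeval Φ (C a)) t = a • t
    rw [aeval_C]
    rfl
  have ev0 : ∀ q : ℤ[X], p ^ (i + 1) • ev q = 0 := by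
    intro q
    rw [← map_nsmul]
    change (aeval Φ (p ^ (i + 1) • q)) t = 0
    rw [map_nsmul, LinearMap.smul_apply, ← map_nsmul, ht, map_zero]
  have key : ∀ n : ℕ, ∀ f : ℤ[X], InU p i (ev f) → (p : ℤ) ∣ f.coeff n := by
    have base : ∀ f : ℤ[X], InU p i (ev f) → (p : ℤ) ∣ f.coeff 0 ∧ InU p i (ev f.divX) := by
      intro f hf
      have hev : ev f = φ (f.coeff 0 • g + ev f.divX) := by
        conv_lhs => rw [← X_mul_divX_add f]
        rw [map_add, evX, evC, map_add, map_zsmul, hgt, add_comm]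
      rw [hev] at hf
      have hf' := ih _ hf
      have hdvd : (p : ℤ) ∣ f.coeff 0 := by
        by_contra hpa
        apply hgU
        obtain ⟨c, d, hcd⟩ : IsCoprime (p : ℤ) (f.coeff 0) :=
          (Nat.prime_iff_prime_int.1 hp).coprime_iff_not_dvd.2 hpa
        have h1 : InU p (i + 1) (f.coeff 0 • g) := by
          have := hf'.succ.sub (InU.of_zero (ev0 f.divX))
          simpa using this
        have h2 := (h1.zsmul d).sub ((InU.of_smul (p := p) (i := i + 1) g).zsmul (-c))
        have h3 : d • (f.coeff 0 • g) - (-c) • (p • g) = g := by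
          rw [← natCast_zsmul g p, smul_smul, smul_smul, ← sub_smul]
          rw [show d * f.coeff 0 - -c * (p : ℤ) = 1 by linarith, one_smul]
        rwa [h3] at h2
      refine ⟨hdvd, ?_⟩
      obtain ⟨e, he⟩ := hdvd
      have h4 := hf'.sub (InU.of_smul (p := p) (i := i) (e • g))
      rw [he, mul_smul, natCast_zsmul] at h4
      simpa using h4
    intro n
    induction n with
    | zero => exact fun f hf => (base f hf).1
    | succ n ihn =>
      intro f hf
      have := ihn f.divX (base f hf).2
      rwa [coeff_divX] at this
  have key' : ∀ f : ℤ[X], InU p i (ev f) → ∃ f', f = p • f' := by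
    intro f hf
    obtain ⟨f', hf'⟩ := (C_dvd_iff_dvd_coeff (p : ℤ) f).2 (fun n => key n f hf)
    exact ⟨f', by rw [hf', nsmul_eq_mul]; simp⟩
  have key2 : ∀ f : ℤ[X], ∀ h : G, ev f = p ^ (i + 1) • h → ∃ f', f = p ^ (i + 1) • f' := by
    intro f h hfh
    have : ∀ k ≤ i + 1, ∃ f', f = p ^ k • f' := by
      intro k
      induction k with
      | zero => intro _; exact ⟨f, by simp⟩
      | succ k ihk =>
        intro hk
        obtain ⟨f', hf'⟩ := ihk (by omega)
        obtain ⟨f'', hf''⟩ := key' f' (by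
          apply InU.of_pow (y := p ^ (i - k) • h)
          rw [show i = (i - k) + k by omega, pow_add, mul_smul, ← map_nsmul ev (p ^ k), ← hf',
            hfh, smul_comm]
          simp only [Nat.add_sub_cancel, smul_smul]
          congr 2
          · congr 1; omega)
        exact ⟨f'', by rw [hf', hf'', smul_smul, pow_succ]⟩
    exact this (i + 1) le_rfl
  let T : Submodule ℤ G := LinearMap.range ev
  obtain ⟨N, hTN⟩ := exists_compl_aux p hp i T (by
      rintro x ⟨f, rfl⟩ h hh
      obtain ⟨f', rfl⟩ := key2 f h hh
      rw [map_nsmul, ev0]) (by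
      rintro x ⟨f, rfl⟩ h
      obtain ⟨f', rfl⟩ := key' f (InU.of_zero h)
      exact ⟨ev f', ⟨f', rfl⟩, map_nsmul ev p f'⟩)
  let dX : ℤ[X] →ₗ[ℤ] ℤ[X] :=
    { toFun := divX
      map_add' := fun a b => divX_add
      map_smul' := fun c a => by ext n; simp [coeff_divX] }
  have hker : LinearMap.ker ev ≤ LinearMap.ker (ev.comp dX) := by
    intro f hf
    obtain ⟨f', rfl⟩ := key2 f 0 (by rw [smul_zero]; exact hf)
    rw [LinearMap.mem_ker, map_nsmul]
    exact ev0 _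
  let s : T →ₗ[ℤ] G :=
    ((LinearMap.ker ev).liftQ (ev.comp dX) hker).comp ev.quotKerEquivRange.symm.toLinearMap
  have hs : ∀ f : ℤ[X], s ⟨ev f, ⟨f, rfl⟩⟩ = ev f.divX := by
    intro f
    have : ev.quotKerEquivRange.symm ⟨ev f, ⟨f, rfl⟩⟩ = (LinearMap.ker ev).mkQ f := by
      rw [LinearEquiv.symm_apply_eq]
      rfl
    change ((LinearMap.ker ev).liftQ (ev.comp dX) hker) (ev.quotKerEquivRange.symm _) = _
    rw [this]
    rfl
  let σ : G →ₗ[ℤ] G := LinearMap.ofIsCompl hTN s N.subtype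
  have hσT : ∀ f : ℤ[X], σ (ev f) = ev f.divX := by
    intro f
    rw [← hs f]
    exact LinearMap.ofIsCompl_apply_left hTN ⟨ev f, ⟨f, rfl⟩⟩
  have hσN : ∀ n ∈ N, σ n = n := fun n hn => LinearMap.ofIsCompl_apply_right hTN ⟨n, hn⟩
  have hσs : Surjective σ := by
    intro x
    obtain ⟨τ, ⟨f, rfl⟩, n, hn, rfl⟩ := Submodule.mem_sup.1
      (show x ∈ T ⊔ N by rw [hTN.sup_eq_top]; trivial)
    refine ⟨ev (X * f) + n, ?_⟩
    rw [map_add, hσT, hσN n hn]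
    congr 2
    ext k
    rw [coeff_divX, coeff_X_mul]
  have ht1 : ev (C 1) = t := by rw [evC, one_smul]
  obtain ⟨y, hy⟩ := ker_le_aux p hp hR σ.toAddMonoidHom hσs t (by
    change σ t = 0
    rw [← ht1, hσT, divX_C, map_zero])
  apply hgU
  apply InU.succ
  apply ih
  rw [hgt, hy]
  exact InU.of_smul y

/-- If `p^ω G` is Hopfian, then the `p`-group `G` is relatively
Hopfian iff it is Hopfian. -/
theorem relativelyHopfian_iff_hopfian_of_pOmega_hopfian (p : ℕ) (hp : p.Prime)
    (G : Type u) [AddCommGroup G] (hG : IsPAddGroup G p)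
    (h : Hopfian ↥(pOmega G p)) : RelativelyHopfian G ↔ Hopfian G := by
  constructor
  · intro hR φ hφ
    have hU : ∀ i : ℕ, ∀ z, InU p i (φ z) → InU p i z := by
      intro i
      induction i with
      | zero =>
        rintro z ⟨a, b, hz, ha⟩
        obtain ⟨b', rfl⟩ := hφ b
        rw [pow_zero, one_smul] at ha
        obtain ⟨y, hy⟩ := ker_le_aux p hp hR φ hφ (z - p • b') (by
          rw [map_sub, map_nsmul, hz, ha]; abel)
        have hz' : z = p • (y + b') := by rw [smul_add, ← hy]; abel
        rw [hz']
        exact InU.of_smul _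
      | succ i ih => exact step_aux p hp hR φ hφ i ih
    have hpow : ∀ n : ℕ, ∀ z, (∃ y, φ z = p ^ n • y) → ∃ y, z = p ^ n • y := by
      intro n
      induction n with
      | zero => intro z _; exact ⟨z, by simp⟩
      | succ n ih =>
        rintro z ⟨y, hy⟩
        obtain ⟨w, rfl⟩ := ih z ⟨p • y, by rw [hy, pow_succ, mul_smul]⟩
        rw [map_nsmul] at hy
        obtain ⟨a, b, rfl, ha⟩ := hU n w (InU.of_pow hy)
        exact ⟨b, by rw [smul_add, ha, zero_add, pow_succ, mul_smul]⟩
    have hmem : ∀ z : G, z ∈ pOmega G p ↔ ∀ n : ℕ, ∃ y, z = p ^ n • y := by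
      intro z
      rw [pOmega, AddSubgroup.mem_iInf]
      exact forall_congr' fun n => ⟨fun ⟨y, hy⟩ => ⟨y, hy.symm⟩, fun ⟨y, hy⟩ => ⟨y, hy.symm⟩⟩
    have hback : ∀ z, φ z ∈ pOmega G p → z ∈ pOmega G p := by
      intro z hz
      rw [hmem] at hz ⊢
      exact fun n => hpow n z (hz n)
    have hfwd : ∀ z, z ∈ pOmega G p → φ z ∈ pOmega G p := by
      intro z hz
      rw [hmem] at hz ⊢
      intro n
      obtain ⟨y, rfl⟩ := hz n
      exact ⟨φ y, map_nsmul φ _ _⟩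
    let ρ : ↥(pOmega G p) →+ ↥(pOmega G p) :=
      (φ.comp (pOmega G p).subtype).codRestrict (pOmega G p) (fun x => hfwd _ x.2)
    have hρ : Injective ρ := h ρ (by
      rintro ⟨y, hy⟩
      obtain ⟨x, rfl⟩ := hφ y
      exact ⟨⟨x, hback x hy⟩, rfl⟩)
    rw [injective_iff_map_eq_zero]
    intro x hx
    have hxm : x ∈ pOmega G p := hback x (by rw [hx]; exact zero_mem _)
    have := (injective_iff_map_eq_zero ρ).1 hρ ⟨x, hxm⟩ (Subtype.ext hx)
    exact congrArg Subtype.val this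
  · intro hH A _ φ hφ
    have hinj := hH ((AddMonoidHom.fst G A).comp φ) (fun g => by
      obtain ⟨x, hx⟩ := hφ (g, 0)
      exact ⟨x, by simp [hx]⟩)
    refine subsingleton_of_forall_eq 0 fun a => ?_
    obtain ⟨x, hx⟩ := hφ (0, a)
    have hx0 : x = 0 := hinj (by simp [hx])
    rw [hx0, map_zero] at hx
    exact (congrArg Prod.snd hx).symm
end

section
/- Let p be a prime and G an abelian p-group such that p^ω G is bounded and G/p^ω G is Hopfian. Then G is relatively Hopfian. -/
open Function

universe u

/-- If `p^ω G` is bounded and `G / p^ω G` is Hopfian, then the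
`p`-group `G` is relatively Hopfian. -/
theorem relativelyHopfian_of_pOmega_bounded (p : ℕ) (hp : p.Prime)
    (G : Type u) [AddCommGroup G] (hG : IsPAddGroup G p)
    (hb : IsBoundedSubgroup (pOmega G p)) (hh : Hopfian (G ⧸ pOmega G p)) :
    RelativelyHopfian G := by
  intro A _ φ hφ
  let f : G →+ G := (AddMonoidHom.fst G A).comp φ
  have hf : ∀ x, f x = (φ x).1 := fun _ => rfl
  have hle : pOmega G p ≤ (pOmega G p).comap f := by
    intro x hx
    rw [AddSubgroup.mem_comap]
    rw [pOmega, AddSubgroup.mem_iInf] at hx ⊢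
    intro n
    obtain ⟨y, hy⟩ := hx n
    have hy' : p ^ n • y = x := hy
    refine ⟨f y, ?_⟩
    change p ^ n • f y = f x
    rw [← map_nsmul, hy']
  have hsurj : Surjective (QuotientAddGroup.map (pOmega G p) (pOmega G p) f hle) := by
    intro z
    induction z using QuotientAddGroup.induction_on with
    | _ g =>
      obtain ⟨x, hx⟩ := hφ (g, 0)
      refine ⟨(x : G ⧸ pOmega G p), ?_⟩
      rw [QuotientAddGroup.map_mk, hf, hx]
  have hinj := hh _ hsurj
  -- every element of `A` comes from an element of `p^ω G`
  have key : ∀ a : A, ∃ x ∈ pOmega G p, (φ x).2 = a := by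
    intro a
    obtain ⟨x, hx⟩ := hφ (0, a)
    refine ⟨x, ?_, by rw [hx]⟩
    rw [← QuotientAddGroup.eq_zero_iff]
    apply hinj
    rw [QuotientAddGroup.map_mk, hf, hx, map_zero]
    rfl
  obtain ⟨n, hn, hnb⟩ := hb
  have hnA : ∀ a : A, n • a = 0 := by
    intro a
    obtain ⟨x, hx, rfl⟩ := key a
    rw [← Prod.smul_snd, ← map_nsmul, hnb x hx, map_zero, Prod.snd_zero]
  obtain ⟨k, m, hpm, hnm⟩ := Nat.exists_eq_pow_mul_and_not_dvd hn.ne' p hp.ne_one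
  have hzero : ∀ a : A, a = 0 := by
    intro a
    obtain ⟨x, hx, rfl⟩ := key a
    obtain ⟨j, hj⟩ := hG x
    have h1 : p ^ j • (φ x).2 = 0 := by
      rw [← Prod.smul_snd, ← map_nsmul, hj, map_zero, Prod.snd_zero]
    have h2 : m • (φ x).2 = 0 := by
      rw [pOmega, AddSubgroup.mem_iInf] at hx
      obtain ⟨y, hy⟩ := hx k
      have hy' : p ^ k • y = x := hy
      rw [← hy', map_nsmul, Prod.smul_snd, ← mul_smul, mul_comm, ← hnm, hnA]
    have hc : Nat.Coprime (p ^ j) m := ((hp.coprime_iff_not_dvd).2 hpm).pow_left j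
    have d1 := addOrderOf_dvd_of_nsmul_eq_zero h1
    have d2 := addOrderOf_dvd_of_nsmul_eq_zero h2
    exact AddMonoid.addOrderOf_eq_one_iff.1 (Nat.eq_one_of_dvd_coprimes hc d1 d2)
  exact ⟨fun a b => by rw [hzero a, hzero b]⟩
end

section
/- For every prime p there exists a reduced abelian p-group H such that p·(p^ω H) = 0, the subgroup p^ω H is infinite, and H is relatively Hopfian but not Hopfian. -/
open Function

universe u

namespace RelHopf

/-- The circle group. -/
abbrev P := UnitAddCircle

theorem exists_nsmul_eq {N : ℕ} (hN : N ≠ 0) (y : P) : ∃ x : P, N • x = y := by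
  refine ⟨DivisibleBy.div y (N : ℤ), ?_⟩
  have := DivisibleBy.div_cancel (α := ℤ) y (n := (N : ℤ)) (by exact_mod_cast hN)
  rwa [natCast_zsmul] at this

theorem finite_tors {N : ℕ} (hN : N ≠ 0) : {x : P | N • x = 0}.Finite :=
  AddCircle.finite_torsion (1 : ℝ) (Nat.pos_of_ne_zero hN)

theorem card_comap {A B : Type*} [AddCommGroup A] [AddCommGroup B] [Finite A]
    (f : A →+ B) (S : AddSubgroup B) :
    Nat.card (S.comap f) = Nat.card f.ker * Nat.card (S ⊓ f.range : AddSubgroup B) := by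
  let g : S.comap f →+ B := f.comp (S.comap f).subtype
  have h1 := AddSubgroup.card_mul_index g.ker
  rw [AddSubgroup.index_ker] at h1
  rw [← h1]
  congr 1
  · apply Nat.card_congr
    exact
      { toFun := fun x => ⟨x.1.1, x.2⟩
        invFun := fun x => ⟨⟨x.1, by
          have : f x.1 = 0 := x.2
          simp [AddSubgroup.mem_comap, this]⟩, x.2⟩
        left_inv := fun x => rfl
        right_inv := fun x => rfl }
  · congr 1
    have : g.range = S ⊓ f.range := by
      ext y
      simp only [AddMonoidHom.mem_range, AddSubgroup.mem_inf, g]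
      constructor
      · rintro ⟨x, rfl⟩
        exact ⟨x.2, x.1, rfl⟩
      · rintro ⟨hy, x, rfl⟩
        exact ⟨⟨x, hy⟩, rfl⟩
    rw [this]

/-- If a finite group endomorphism hits all the `N`-torsion, its kernel is divisible by `N`. -/
theorem ker_le {F : Type*} [AddCommGroup F] [Finite F] (f : F →+ F) (N : ℕ)
    (h : ∀ y, N • y = 0 → ∃ x, f x = y) (x : F) (hx : f x = 0) : ∃ z, N • z = x := by
  let μ : F →+ F := nsmulHom F N
  have hμ : ∀ y, μ y = N • y := fun y => rfl
  have h1 := card_comap f μ.ker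
  have h2 := card_comap μ f.ker
  have e : μ.ker.comap f = f.ker.comap μ := by
    ext y
    simp [AddSubgroup.mem_comap, AddMonoidHom.mem_ker, hμ]
  have e2 : μ.ker ⊓ f.range = μ.ker := by
    apply inf_eq_left.2
    intro y hy
    exact h y hy
  rw [e, h2, e2, mul_comm] at h1
  have h3 : Nat.card (f.ker ⊓ μ.range : AddSubgroup F) = Nat.card f.ker :=
    Nat.eq_of_mul_eq_mul_right Nat.card_pos h1
  have h4 : f.ker ⊓ μ.range = f.ker :=
    AddSubgroup.eq_of_le_of_card_ge inf_le_left h3.ge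
  have h5 : x ∈ f.ker ⊓ μ.range := by rw [h4]; exact hx
  exact h5.2

/-- Baire category for an increasing chain of closed subgroups. -/
theorem baire {Y : Type*} [AddCommGroup Y] [TopologicalSpace Y] [IsTopologicalAddGroup Y]
    [CompactSpace Y] [T2Space Y] (S : ℕ → AddSubgroup Y) (hm : Monotone S)
    (hc : ∀ n, IsClosed (S n : Set Y)) (hU : ∀ y, ∃ n, y ∈ S n) : ∃ n, S n = ⊤ := by
  obtain ⟨n, y, hy⟩ := nonempty_interior_of_iUnion_of_closed hc (by
    ext y; simpa using hU y)
  have ho : IsOpen (S n : Set Y) :=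
    AddSubgroup.isOpen_of_mem_nhds (g := y) _ (mem_interior_iff_mem_nhds.1 hy)
  obtain ⟨k, hk⟩ := isCompact_univ.elim_directed_cover (fun k => (S (n + k) : Set Y))
    (fun k => AddSubgroup.isOpen_mono (hm (Nat.le_add_right n k)) ho)
    (by
      intro y _
      obtain ⟨m, hmm⟩ := hU y
      exact Set.mem_iUnion.2 ⟨m, hm (Nat.le_add_left m n) hmm⟩)
    (by
      apply Monotone.directed_le
      intro a b hab
      exact hm (Nat.add_le_add_left hab n))
  refine ⟨n + k, ?_⟩
  ext y
  simpa using hk (Set.mem_univ y)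

/-- Torsion-complete group with exponents `e`. -/
def T (p : ℕ) (e : ℕ → ℕ) : AddSubgroup (ℕ → P) where
  carrier := {x | (∀ i, p ^ e i • x i = 0) ∧ ∃ k, ∀ i, p ^ k • x i = 0}
  zero_mem' := ⟨by simp, 0, by simp⟩
  add_mem' := by
    rintro a b ⟨h1, k, hk⟩ ⟨h2, l, hl⟩
    refine ⟨fun i => by simp [h1, h2], k + l, fun i => ?_⟩
    have ha : p ^ (k + l) • a i = 0 := by rw [pow_add, mul_comm, mul_smul, hk, smul_zero]
    have hb : p ^ (k + l) • b i = 0 := by rw [pow_add, mul_smul, hl, smul_zero]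
    simp [ha, hb]
  neg_mem' := by
    rintro a ⟨h1, k, hk⟩
    exact ⟨fun i => by simp [h1], k, fun i => by simp [hk]⟩

theorem pow_smul_le {A : Type*} [AddCommGroup A] {p a b : ℕ} (hab : a ≤ b) {x : A}
    (h : p ^ a • x = 0) : p ^ b • x = 0 := by
  obtain ⟨c, rfl⟩ := Nat.exists_eq_add_of_le hab
  rw [pow_add, mul_comm, mul_smul, h, smul_zero]

theorem T_tors {p : ℕ} {e : ℕ → ℕ} (x : T p e) : ∃ k, p ^ k • x = 0 := by
  obtain ⟨k, hk⟩ := x.2.2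
  exact ⟨k, by ext i; exact hk i⟩

/-- Truncation. -/
noncomputable def trunc (p : ℕ) (e : ℕ → ℕ) (I : ℕ) : T p e →+ T p e where
  toFun x := ⟨fun i => if i ≤ I then x.1 i else 0, by
    obtain ⟨h1, k, hk⟩ := x.2
    refine ⟨fun i => ?_, k, fun i => ?_⟩
    · beta_reduce
      split_ifs
      · exact h1 i
      · simp
    · beta_reduce
      split_ifs
      · exact hk i
      · simp⟩
  map_zero' := by ext i; simp
  map_add' x y := by
    ext i
    by_cases h : i ≤ I <;> simp [h]

theorem trunc_apply {p : ℕ} {e : ℕ → ℕ} (I : ℕ) (x : T p e) (i : ℕ) :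
    (trunc p e I x).1 i = if i ≤ I then x.1 i else 0 := rfl

theorem finite_trunc {p : ℕ} (hp : p ≠ 0) {e : ℕ → ℕ} (I : ℕ) :
    Finite (trunc p e I).range := by
  have : Finite (∀ i : Fin (I + 1), {x : P | p ^ e i • x = 0}) := by
    have : ∀ i : Fin (I + 1), Finite {x : P | p ^ e i • x = 0} := fun i =>
      (finite_tors (pow_ne_zero _ hp)).to_subtype
    infer_instance
  refine Finite.of_injective (β := ∀ i : Fin (I + 1), {x : P | p ^ e i • x = 0})
    (fun x i => ⟨x.1.1 i, x.1.2.1 i⟩) ?_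
  rintro ⟨_, x, rfl⟩ ⟨_, y, rfl⟩ h
  ext i
  by_cases hi : i ≤ I
  · have := congrFun h ⟨i, Nat.lt_succ_of_le hi⟩
    simpa using this
  · simp [trunc_apply, hi]

/-- The exponents. -/
def sq : ℕ → ℕ := fun i => i ^ 2

theorem trunc_tail {p : ℕ} (hp : p ≠ 0) (φ : T p sq →+ T p sq)
    (k I : ℕ) (hk : k ≤ I) (x : T p sq) (hx : p ^ k • x = 0) :
    trunc p _ I (φ x) = trunc p _ I (φ (trunc p _ I x)) := by
  have hx' : ∀ i, p ^ k • x.1 i = 0 := fun i => congrFun (congrArg Subtype.val hx) i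
  have H : ∀ i, ∃ z : P, p ^ (I ^ 2) • z = x.1 i := fun i =>
    exists_nsmul_eq (pow_ne_zero _ hp) _
  choose z hz using H
  have hz2 : ∀ i, p ^ (k + I ^ 2) • z i = 0 := fun i => by
    rw [pow_add, mul_smul, hz, hx']
  let w : T p sq := ⟨fun i => if i ≤ I then 0 else z i, by
    refine ⟨fun i => ?_, k + I ^ 2, fun i => ?_⟩
    · beta_reduce
      split_ifs with h
      · simp
      · exact pow_smul_le (by unfold sq; nlinarith) (hz2 i)
    · beta_reduce
      split_ifs with h
      · simp
      · exact hz2 i⟩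
  have hw : x = trunc p _ I x + p ^ (I ^ 2) • w := by
    ext i
    by_cases h : i ≤ I
    · simp [trunc_apply, h, w]
    · simp [trunc_apply, h, w, hz]
  conv_lhs => rw [hw]
  rw [map_add, map_add, map_nsmul]
  rw [add_eq_left]
  ext i
  by_cases h : i ≤ I
  · simp only [trunc_apply, h, if_true]
    exact pow_smul_le (Nat.pow_le_pow_left h 2) ((φ w).2.1 i)
  · simp [trunc_apply, h]

/-- The compact group of `p ^ m`-torsion. -/
def Y (p m : ℕ) (e : ℕ → ℕ) : AddSubgroup (ℕ → P) where
  carrier := {x | (∀ i, p ^ e i • x i = 0) ∧ ∀ i, p ^ m • x i = 0}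
  zero_mem' := by simp
  add_mem' := by
    rintro a b ⟨h1, hk⟩ ⟨h2, hl⟩
    exact ⟨fun i => by simp [h1, h2], fun i => by simp [hk, hl]⟩
  neg_mem' := by
    rintro a ⟨h1, hk⟩
    exact ⟨fun i => by simp [h1], fun i => by simp [hk]⟩

theorem Y_compact (p m : ℕ) (e : ℕ → ℕ) : CompactSpace (Y p m e) := by
  refine isCompact_iff_compactSpace (s := (Y p m e : Set (ℕ → P))).1 ?_
  apply IsClosed.isCompact
  have : (Y p m e : Set (ℕ → P)) =
      (⋂ i, {x | p ^ e i • x i = 0}) ∩ ⋂ i, {x | p ^ m • x i = 0} := by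
    ext x; simp [Y]
  rw [this]
  refine (isClosed_iInter fun i => ?_).inter (isClosed_iInter fun i => ?_)
  · exact isClosed_eq (by fun_prop) continuous_const
  · exact isClosed_eq (by fun_prop) continuous_const

/-- Inclusion. -/
def Yincl (p m : ℕ) (e : ℕ → ℕ) : Y p m e →+ T p e :=
  AddSubgroup.inclusion fun _ hx => ⟨hx.1, m, hx.2⟩

theorem hopf {p : ℕ} (hp : p ≠ 0) : Hopfian (T p sq) := by
  intro φ hφ
  rw [injective_iff_map_eq_zero]
  intro s hs
  ext r
  set m := sq r with hm
  have := Y_compact p m sq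
  let R : ℕ → AddSubgroup (T p sq) := fun I =>
    ((trunc p sq I).comp (φ.comp (trunc p sq I))).range
  have hRfin : ∀ I, Set.Finite (R I : Set (T p sq)) := by
    intro I
    have := finite_trunc hp (e := sq) I
    have h2 : Set.Finite ((trunc p sq I).range : Set (T p sq)) := Set.toFinite _
    refine h2.subset ?_
    rintro _ ⟨x, rfl⟩
    exact ⟨_, rfl⟩
  let S : ℕ → AddSubgroup (Y p m sq) := fun J =>
    ⨅ I, ⨅ _ : J ≤ I, (R I).comap ((trunc p sq I).comp (Yincl p m sq))
  have hS : ∀ J y, y ∈ S J ↔ ∀ I, J ≤ I → trunc p sq I (Yincl p m sq y) ∈ R I := by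
    intro J y
    simp [S, AddSubgroup.mem_iInf]
  obtain ⟨J, hJ⟩ := baire S
    (by
      intro a b hab y hy
      rw [hS] at hy ⊢
      exact fun I hI => hy I (hab.trans hI))
    (by
      intro J
      have : (S J : Set (Y p m sq)) =
          ⋂ I, ⋂ _ : J ≤ I, (fun y => trunc p sq I (Yincl p m sq y)) ⁻¹' (R I : Set (T p sq)) := by
        ext y
        simp [hS]
      rw [this]
      refine isClosed_iInter fun I => isClosed_iInter fun _ => ?_
      refine (hRfin I).isClosed.preimage ?_
      refine Continuous.subtype_mk (continuous_pi fun i => ?_) _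
      by_cases h : i ≤ I
      · simp only [h, if_true]
        exact (continuous_apply i).comp continuous_subtype_val
      · simp only [h, if_false]
        exact continuous_const)
    (by
      intro y
      obtain ⟨x, hx⟩ := hφ (Yincl p m sq y)
      obtain ⟨k, hk⟩ := T_tors x
      refine ⟨k, (hS _ _).2 fun I hI => ?_⟩
      rw [← hx, trunc_tail hp φ k I hI x hk]
      exact ⟨x, rfl⟩)
  obtain ⟨k, hk⟩ := T_tors s
  let I := max (max J k) r
  have hIJ : J ≤ I := (le_max_left _ _).trans (le_max_left _ _)
  have hIk : k ≤ I := (le_max_right _ _).trans (le_max_left _ _)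
  have hIr : r ≤ I := le_max_right _ _
  have := finite_trunc hp (e := sq) I
  let f : (trunc p sq I).range →+ (trunc p sq I).range :=
    (trunc p sq I).rangeRestrict.comp (φ.comp (trunc p sq I).range.subtype)
  have idem : ∀ x, trunc p sq I (trunc p sq I x) = trunc p sq I x := by
    intro x
    ext i
    by_cases h : i ≤ I <;> simp [trunc_apply, h]
  obtain ⟨z, hz⟩ := ker_le f (p ^ m) (by
    rintro ⟨_, y, rfl⟩ hy
    have hy2 : p ^ m • trunc p sq I y = 0 := congrArg Subtype.val hy
    let y' : Y p m sq := ⟨(trunc p sq I y).1, (trunc p sq I y).2.1, fun i =>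
      congrFun (congrArg Subtype.val hy2) i⟩
    have h1 : y' ∈ S J := by rw [hJ]; trivial
    obtain ⟨x, hx⟩ := (hS _ _).1 h1 I hIJ
    refine ⟨⟨trunc p sq I x, x, rfl⟩, ?_⟩
    apply Subtype.ext
    refine Eq.trans hx ?_
    exact idem y) ⟨trunc p sq I s, s, rfl⟩ (by
    apply Subtype.ext
    change trunc p sq I (φ (trunc p sq I s)) = 0
    rw [← trunc_tail hp φ k I hIk s hk, hs, map_zero])
  have h1 := congrFun (congrArg Subtype.val (congrArg Subtype.val hz)) r
  have h2 : p ^ m • z.1.1 r = s.1 r := by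
    refine Eq.trans h1 ?_
    simp [trunc_apply, hIr]
  rw [← h2]
  exact z.1.2.1 r

/-- The exponents of `K`. -/
def sq1 : ℕ → ℕ := fun i => i ^ 2 + 1

/-- Finitely supported socle elements. -/
def L (p : ℕ) : AddSubgroup (T p sq1) where
  carrier := {x | p • x = 0 ∧ ∃ N, ∀ i, N ≤ i → x.1 i = 0}
  zero_mem' := ⟨by simp, 0, by simp⟩
  add_mem' := by
    rintro a b ⟨h1, M, hM⟩ ⟨h2, N, hN⟩
    refine ⟨by simp [h1, h2], max M N, fun i hi => ?_⟩
    have ha := hM i ((le_max_left _ _).trans hi)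
    have hb := hN i ((le_max_right _ _).trans hi)
    simp [ha, hb]
  neg_mem' := by
    rintro a ⟨h1, N, hN⟩
    exact ⟨by simp [h1], N, fun i hi => by simp [hN i hi]⟩

/-- Multiplication by `p` as a map onto the smaller group. -/
def q0 (p : ℕ) : T p sq1 →+ T p sq where
  toFun x := ⟨fun i => p • x.1 i, by
    obtain ⟨h1, k, hk⟩ := x.2
    refine ⟨fun i => ?_, k, fun i => ?_⟩
    · have := h1 i
      rw [sq1, pow_succ, mul_smul] at this
      exact this
    · change p ^ k • (p • x.1 i) = 0
      rw [smul_comm, hk, smul_zero]⟩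
  map_zero' := by ext i; simp
  map_add' x y := by ext i; simp

theorem q0_eq_zero {p : ℕ} (x : T p sq1) : q0 p x = 0 ↔ p • x = 0 := by
  constructor
  · intro h
    ext i
    exact congrFun (congrArg Subtype.val h) i
  · intro h
    ext i
    exact congrFun (congrArg Subtype.val h) i

theorem q0_surj {p : ℕ} (hp : p ≠ 0) : Surjective (q0 p) := by
  intro y
  choose x hx using fun i => exists_nsmul_eq hp (y.1 i)
  obtain ⟨h1, k, hk⟩ := y.2
  refine ⟨⟨x, fun i => ?_, k + 1, fun i => ?_⟩, ?_⟩
  · rw [sq1, pow_succ, mul_smul, hx]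
    exact h1 i
  · rw [pow_succ, mul_smul, hx]
    exact hk i
  · ext i
    exact hx i

/-- The example. -/
abbrev HH (p : ℕ) := T p sq1 ⧸ L p

/-- The quotient map. -/
def q (p : ℕ) : HH p →+ T p sq :=
  QuotientAddGroup.lift (L p) (q0 p) fun x hx => (q0_eq_zero x).2 hx.1

theorem q_mk {p : ℕ} (x : T p sq1) : q p (QuotientAddGroup.mk x : HH p) = q0 p x := rfl

theorem q_surj {p : ℕ} (hp : p ≠ 0) : Surjective (q p) := fun y => by
  obtain ⟨x, hx⟩ := q0_surj hp y
  exact ⟨QuotientAddGroup.mk x, hx⟩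

theorem smul_of_q {p : ℕ} (h : HH p) (hq : q p h = 0) : p • h = 0 := by
  induction h using QuotientAddGroup.induction_on with
  | _ x =>
    rw [q_mk, q0_eq_zero] at hq
    rw [← QuotientAddGroup.mk_nsmul, hq, QuotientAddGroup.mk_zero]

theorem q_of_div {p : ℕ} (h : HH p) (hd : ∀ n : ℕ, ∃ h', p ^ n • h' = h) : q p h = 0 := by
  ext i
  obtain ⟨h', rfl⟩ := hd (sq i)
  rw [map_nsmul]
  exact (q p h').2.1 i

theorem div_of_q {p : ℕ} (hp : p ≠ 0) (h : HH p) (hq : q p h = 0) (n : ℕ) :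
    ∃ h', p ^ n • h' = h := by
  induction h using QuotientAddGroup.induction_on with
  | _ x =>
    rw [q_mk, q0_eq_zero] at hq
    have hx : ∀ i, p • x.1 i = 0 := fun i => congrFun (congrArg Subtype.val hq) i
    choose z hz using fun i => exists_nsmul_eq (pow_ne_zero n hp) (x.1 i)
    have hz2 : ∀ i, p ^ (n + 1) • z i = 0 := fun i => by
      rw [pow_succ, mul_comm, mul_smul, hz, hx]
    let w : T p sq1 := ⟨fun i => if i < n then 0 else z i, by
      refine ⟨fun i => ?_, n + 1, fun i => ?_⟩
      · beta_reduce
        split_ifs with h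
        · simp
        · exact pow_smul_le (by unfold sq1; nlinarith) (hz2 i)
      · beta_reduce
        split_ifs with h
        · simp
        · exact hz2 i⟩
    refine ⟨QuotientAddGroup.mk w, ?_⟩
    rw [← QuotientAddGroup.mk_nsmul, QuotientAddGroup.eq]
    have hw : ∀ i, (-(p ^ n • w) + x).1 i = if i < n then x.1 i else 0 := by
      intro i
      by_cases h : i < n
      · simp [w, h]
      · simp [w, h, hz]
    refine ⟨?_, n, fun i hi => ?_⟩
    · ext i
      change p • ((-(p ^ n • w) + x).1 i) = 0
      rw [hw]
      split_ifs
      · exact hx i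
      · simp
    · rw [hw, if_neg (by omega)]

theorem mem_pOmega {p : ℕ} (hp : p ≠ 0) (h : HH p) : h ∈ pOmega (HH p) p ↔ q p h = 0 := by
  have : h ∈ pOmega (HH p) p ↔ ∀ n : ℕ, ∃ h', p ^ n • h' = h := by
    rw [pOmega, AddSubgroup.mem_iInf]
    exact Iff.rfl
  rw [this]
  exact ⟨q_of_div h, fun hq n => div_of_q hp h hq n⟩

theorem relHopf {p : ℕ} (hp : p ≠ 0) : RelativelyHopfian (HH p) := by
  intro A _ Φ hΦ
  let α : HH p →+ HH p := (AddMonoidHom.fst _ _).comp Φ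
  let π : HH p →+ A := (AddMonoidHom.snd _ _).comp Φ
  have hsurj : ∀ h a, ∃ x, α x = h ∧ π x = a := fun h a => by
    obtain ⟨x, hx⟩ := hΦ (h, a)
    exact ⟨x, congrArg Prod.fst hx, congrArg Prod.snd hx⟩
  have hk : ∀ x, q p x = 0 → q p (α x) = 0 := by
    intro x hx
    apply q_of_div
    intro n
    obtain ⟨y, hy⟩ := div_of_q hp x hx n
    exact ⟨α y, by rw [← map_nsmul, hy]⟩
  let β : T p sq →+ T p sq := (q p).liftOfSurjective (q_surj hp) ⟨(q p).comp α, hk⟩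
  have hβ : ∀ x, β (q p x) = q p (α x) := fun x =>
    (q p).liftOfRightInverse_comp_apply _ _ ⟨(q p).comp α, hk⟩ x
  have hβs : Surjective β := by
    intro y
    obtain ⟨h, rfl⟩ := q_surj hp y
    obtain ⟨x, hx, -⟩ := hsurj h 0
    exact ⟨q p x, by rw [hβ, hx]⟩
  have hβi := hopf hp β hβs
  have key : ∀ x, α x = 0 → q p x = 0 := by
    intro x hx
    apply hβi
    rw [hβ, hx, map_zero, map_zero]
  have hpA : ∀ a : A, p • a = 0 := by
    intro a
    obtain ⟨x, hx, rfl⟩ := hsurj 0 a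
    rw [← map_nsmul, smul_of_q x (key x hx), map_zero]
  refine subsingleton_of_forall_eq 0 fun a => ?_
  obtain ⟨x, hx, rfl⟩ := hsurj 0 a
  obtain ⟨y, hy⟩ := div_of_q hp x (key x hx) 1
  rw [← hy, pow_one, map_nsmul, hpA]

/-- Right shift. -/
def shift (x : ℕ → P) : ℕ → P
  | 0 => 0
  | i + 1 => x i

theorem shift_add (x y : ℕ → P) : shift (x + y) = shift x + shift y := by
  ext i; cases i <;> simp [shift]

/-- The automorphism `1 + shift`. -/
def γ (p : ℕ) : T p sq1 →+ T p sq1 where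
  toFun x := ⟨x.1 + shift x.1, by
    refine (T p sq1).add_mem x.2 ?_
    obtain ⟨h1, k, hk⟩ := x.2
    refine ⟨fun i => ?_, k, fun i => ?_⟩
    · cases i with
      | zero => simp [shift]
      | succ i => exact pow_smul_le (by unfold sq1; gcongr; omega) (h1 i)
    · cases i with
      | zero => simp [shift]
      | succ i => exact hk i⟩
  map_zero' := by
    ext i; cases i <;> simp [shift]
  map_add' x y := by
    apply Subtype.ext
    change (x.1 + y.1) + shift (x.1 + y.1) = (x.1 + shift x.1) + (y.1 + shift y.1)
    rw [shift_add]
    abel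

theorem γ_zero {p : ℕ} (x : T p sq1) : (γ p x).1 0 = x.1 0 := by
  change x.1 0 + 0 = _
  simp

theorem γ_succ {p : ℕ} (x : T p sq1) (i : ℕ) : (γ p x).1 (i + 1) = x.1 (i + 1) + x.1 i := rfl

/-- Solving `(1 + shift) x = y`. -/
noncomputable def inv (y : ℕ → P) : ℕ → P
  | 0 => y 0
  | i + 1 => y (i + 1) - inv y i

theorem inv_tors {p k : ℕ} (y : ℕ → P) (i : ℕ) (h : ∀ j ≤ i, p ^ k • y j = 0) :
    p ^ k • inv y i = 0 := by
  induction i with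
  | zero => exact h 0 le_rfl
  | succ i ih =>
    rw [inv, smul_sub, h _ le_rfl, ih fun j hj => h j (hj.trans (Nat.le_succ i)), sub_zero]

theorem γ_surj {p : ℕ} : Surjective (γ p) := by
  intro y
  obtain ⟨h1, k, hk⟩ := y.2
  refine ⟨⟨inv y.1, fun i => inv_tors _ _ fun j hj => ?_, k, fun i =>
    inv_tors _ _ fun j _ => hk j⟩, ?_⟩
  · exact pow_smul_le (by unfold sq1; gcongr) (h1 j)
  · ext i
    cases i with
    | zero => rw [γ_zero]; rfl
    | succ i => rw [γ_succ]; simp [inv]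

theorem γ_L {p : ℕ} (x : T p sq1) (hx : x ∈ L p) : γ p x ∈ L p := by
  obtain ⟨h, N, hN⟩ := hx
  refine ⟨by rw [← map_nsmul, h, map_zero], N + 1, fun i hi => ?_⟩
  cases i with
  | zero => omega
  | succ i => rw [γ_succ, hN _ (by omega), hN _ (by omega), add_zero]

/-- The induced map on the quotient. -/
def Γ (p : ℕ) : HH p →+ HH p := QuotientAddGroup.map (L p) (L p) (γ p) γ_L

theorem Γ_surj {p : ℕ} : Surjective (Γ p) := by
  intro h
  induction h using QuotientAddGroup.induction_on with
  | _ y =>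
    obtain ⟨x, rfl⟩ := γ_surj y
    exact ⟨QuotientAddGroup.mk x, rfl⟩

theorem Γ_ker {p : ℕ} (hp : p.Prime) : ∃ h : HH p, h ≠ 0 ∧ Γ p h = 0 ∧ q p h = 0 := by
  obtain ⟨c, hc0, hc⟩ : ∃ c : P, c ≠ 0 ∧ p • c = 0 := by
    have ho := AddCircle.addOrderOf_period_div (p := (1 : ℝ)) hp.pos
    refine ⟨(((1 : ℝ) / p : ℝ) : AddCircle (1 : ℝ)), ?_, ?_⟩
    · intro h0
      rw [h0, addOrderOf_zero] at ho
      exact hp.one_lt.ne ho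
    · rw [← addOrderOf_dvd_iff_nsmul_eq_zero, ho]
  have hs : ∀ i : ℕ, p • ((-1 : ℤ) ^ i • c) = 0 := fun i => by
    rw [smul_comm, hc, smul_zero]
  let x : T p sq1 := ⟨fun i => (-1 : ℤ) ^ i • c, fun i => by
      refine pow_smul_le (a := 1) (by unfold sq1; omega) ?_
      rw [pow_one]; exact hs i, 1, fun i => by rw [pow_one]; exact hs i⟩
  have hpx : p • x = 0 := by
    ext i; exact hs i
  refine ⟨QuotientAddGroup.mk x, ?_, ?_, ?_⟩
  · intro h0
    rw [QuotientAddGroup.eq_zero_iff] at h0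
    obtain ⟨-, N, hN⟩ := h0
    have h1 : (-1 : ℤ) ^ N • c = 0 := hN N le_rfl
    rcases neg_one_pow_eq_or ℤ N with h | h <;> rw [h] at h1 <;> simp at h1 <;> exact hc0 h1
  · change (QuotientAddGroup.mk (γ p x) : HH p) = 0
    rw [QuotientAddGroup.eq_zero_iff]
    refine ⟨by rw [← map_nsmul, hpx, map_zero], 1, fun i hi => ?_⟩
    cases i with
    | zero => omega
    | succ i =>
      rw [γ_succ]
      simp [x, pow_succ]
  · rw [q_mk, q0_eq_zero, hpx]

theorem Γ_V {p : ℕ} (h : HH p) (hq : q p h = 0) : q p (Γ p h) = 0 := by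
  induction h using QuotientAddGroup.induction_on with
  | _ x =>
    rw [q_mk, q0_eq_zero] at hq
    change q0 p (γ p x) = 0
    rw [q0_eq_zero, ← map_nsmul, hq, map_zero]

theorem Γ_V_surj {p : ℕ} (h : HH p) (hq : q p h = 0) : ∃ h', q p h' = 0 ∧ Γ p h' = h := by
  induction h using QuotientAddGroup.induction_on with
  | _ y =>
    rw [q_mk, q0_eq_zero] at hq
    have hy : ∀ i, p • y.1 i = 0 := fun i => congrFun (congrArg Subtype.val hq) i
    have ht : ∀ i, p ^ 1 • inv y.1 i = 0 := fun i =>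
      inv_tors _ _ fun j _ => by rw [pow_one]; exact hy j
    let x : T p sq1 := ⟨inv y.1, fun i => pow_smul_le (by unfold sq1; omega) (ht i), 1, ht⟩
    refine ⟨QuotientAddGroup.mk x, ?_, ?_⟩
    · rw [q_mk, q0_eq_zero]
      ext i
      have := ht i
      rw [pow_one] at this
      exact this
    · have : γ p x = y := by
        ext i
        cases i with
        | zero => rw [γ_zero]; rfl
        | succ i => rw [γ_succ]; simp [x, inv]
      change (QuotientAddGroup.mk (γ p x) : HH p) = _
      rw [this]

theorem infinite_V {p : ℕ} (hp : p.Prime) : Infinite (pOmega (HH p) p) := by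
  by_contra hf
  rw [not_infinite_iff_finite] at hf
  have hm := mem_pOmega hp.ne_zero
  let f : pOmega (HH p) p → pOmega (HH p) p := fun h =>
    ⟨Γ p h.1, (hm _).2 (Γ_V _ ((hm _).1 h.2))⟩
  have hs : Surjective f := by
    rintro ⟨h, hh⟩
    obtain ⟨h', h1, h2⟩ := Γ_V_surj h ((hm _).1 hh)
    exact ⟨⟨h', (hm _).2 h1⟩, Subtype.ext h2⟩
  have hi := Finite.injective_iff_surjective.2 hs
  obtain ⟨h, h0, h1, h2⟩ := Γ_ker hp
  have h3 : (⟨h, (hm _).2 h2⟩ : pOmega (HH p) p) = 0 := by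
    apply hi
    apply Subtype.ext
    change Γ p h = Γ p 0
    rw [h1, map_zero]
  exact h0 (congrArg Subtype.val h3)

end RelHopf

/-- For every prime `p` there is a reduced `p`-group `H` with
`p • (p^ω H) = 0`, `p^ω H` infinite, which is relatively Hopfian but not Hopfian. -/
theorem exists_relativelyHopfian_not_hopfian (p : ℕ) (hp : p.Prime) :
    ∃ (H : Type) (_ : AddCommGroup H), IsPAddGroup H p ∧ ReducedGroup H ∧
      (∀ x ∈ pOmega H p, p • x = 0) ∧ Infinite ↥(pOmega H p) ∧
      RelativelyHopfian H ∧ ¬ Hopfian H := by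
  have hm := RelHopf.mem_pOmega hp.ne_zero
  refine ⟨RelHopf.HH p, inferInstance, ?_, ?_, ?_, RelHopf.infinite_V hp,
    RelHopf.relHopf hp.ne_zero, ?_⟩
  · intro h
    induction h using QuotientAddGroup.induction_on with
    | _ x =>
      obtain ⟨k, hk⟩ := RelHopf.T_tors x
      exact ⟨k, by rw [← QuotientAddGroup.mk_nsmul, hk, QuotientAddGroup.mk_zero]⟩
  · intro D hD
    rw [eq_bot_iff]
    intro x hx
    obtain ⟨y, hy, rfl⟩ := hD p hp.pos x hx
    rw [AddSubgroup.mem_bot]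
    apply RelHopf.smul_of_q
    apply RelHopf.q_of_div
    intro n
    obtain ⟨z, -, hz⟩ := hD (p ^ n) (pow_pos hp.pos n) y hy
    exact ⟨z, hz⟩
  · intro x hx
    exact RelHopf.smul_of_q x ((hm x).1 hx)
  · intro hH
    obtain ⟨h, h0, h1, -⟩ := RelHopf.Γ_ker hp
    exact h0 (hH _ RelHopf.Γ_surj (by rw [h1, map_zero]))
end

section
/- Let p be a prime, G an abelian group, N a pure subgroup of G, and k a natural number. Then the Ulm invariants satisfy f_k(G) = f_k(G/N) + f_k(N) (as an equality of cardinal numbers). -/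
open Function

universe u

theorem mem_ulmSub_iff {G : Type u} [AddCommGroup G] (p k : ℕ) (x : G) :
    x ∈ ulmSub G p k ↔ (∃ y : G, p ^ k • y = x) ∧ p • x = 0 := Iff.rfl

theorem map_mem_ulmSub {G H : Type u} [AddCommGroup G] [AddCommGroup H] (f : G →+ H)
    (p k : ℕ) (x : G) (hx : x ∈ ulmSub G p k) : f x ∈ ulmSub H p k := by
  rw [mem_ulmSub_iff] at *
  obtain ⟨⟨y, hy⟩, h⟩ := hx
  exact ⟨⟨f y, by rw [← map_nsmul, hy]⟩, by rw [← map_nsmul, h, map_zero]⟩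

theorem ulmSub_succ_le {G : Type u} [AddCommGroup G] (p k : ℕ) (x : G)
    (hx : x ∈ ulmSub G p (k + 1)) : x ∈ ulmSub G p k := by
  rw [mem_ulmSub_iff] at *
  obtain ⟨⟨y, hy⟩, h⟩ := hx
  exact ⟨⟨p • y, by rw [← mul_smul, ← pow_succ, hy]⟩, h⟩

/-- Restriction of a homomorphism to `(p^k G)[p]`. -/
def ulmSubMap {G H : Type u} [AddCommGroup G] [AddCommGroup H] (f : G →+ H) (p k : ℕ) :
    ulmSub G p k →+ ulmSub H p k :=
  (f.comp (ulmSub G p k).subtype).codRestrict (ulmSub H p k)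
    (fun x => map_mem_ulmSub f p k x x.2)

/-- The homomorphism induced on Ulm quotients. -/
def ulmMap {G H : Type u} [AddCommGroup G] [AddCommGroup H] (f : G →+ H) (p k : ℕ) :
    UlmQuot G p k →+ UlmQuot H p k :=
  QuotientAddGroup.map _ _ (ulmSubMap f p k)
    (fun x hx => map_mem_ulmSub f p (k + 1) x hx)

theorem ulm_lift {p : ℕ} (hp : p.Prime) {G : Type u} [AddCommGroup G]
    (N : AddSubgroup G) (hN : IsPureSubgroup N) (k : ℕ) (x : G ⧸ N)
    (hx : x ∈ ulmSub (G ⧸ N) p k) :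
    ∃ y ∈ ulmSub G p k, QuotientAddGroup.mk' N y = x := by
  rw [mem_ulmSub_iff] at hx
  obtain ⟨⟨z, hz⟩, h⟩ := hx
  obtain ⟨y, rfl⟩ := QuotientAddGroup.mk'_surjective N z
  subst hz
  rw [← mul_smul, ← pow_succ', ← map_nsmul] at h
  have h' : p ^ (k + 1) • y ∈ N := (QuotientAddGroup.eq_zero_iff _).1 h
  obtain ⟨n, hn, e⟩ := hN _ (pow_pos hp.pos (k + 1)) _ h' ⟨y, rfl⟩
  refine ⟨p ^ k • (y - n), ?_, ?_⟩
  · rw [mem_ulmSub_iff]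
    refine ⟨⟨_, rfl⟩, ?_⟩
    rw [← mul_smul, ← pow_succ', smul_sub, e, sub_self]
  · have : QuotientAddGroup.mk' N n = 0 := (QuotientAddGroup.eq_zero_iff _).2 hn
    rw [map_nsmul, map_sub, this, sub_zero]

theorem ulm_restrict {p : ℕ} (hp : p.Prime) {G : Type u} [AddCommGroup G]
    (N : AddSubgroup G) (hN : IsPureSubgroup N) (k : ℕ) (x : N)
    (hx : (x : G) ∈ ulmSub G p k) : x ∈ ulmSub N p k := by
  rw [mem_ulmSub_iff] at *
  obtain ⟨h1, h2⟩ := hx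
  obtain ⟨n, hn, e⟩ := hN _ (pow_pos hp.pos k) _ x.2 h1
  exact ⟨⟨⟨n, hn⟩, Subtype.ext e⟩, Subtype.ext h2⟩

theorem ulmMap_surjective {p : ℕ} (hp : p.Prime) {G : Type u} [AddCommGroup G]
    (N : AddSubgroup G) (hN : IsPureSubgroup N) (k : ℕ) :
    Surjective (ulmMap (QuotientAddGroup.mk' N) p k) := by
  intro x
  induction x using QuotientAddGroup.induction_on with
  | _ a =>
    obtain ⟨y, hy, e⟩ := ulm_lift hp N hN k a a.2
    exact ⟨QuotientAddGroup.mk ⟨y, hy⟩, congrArg QuotientAddGroup.mk (Subtype.ext e)⟩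

theorem ulmMap_injective {p : ℕ} (hp : p.Prime) {G : Type u} [AddCommGroup G]
    (N : AddSubgroup G) (hN : IsPureSubgroup N) (k : ℕ) :
    Injective (ulmMap N.subtype p k) := by
  rw [injective_iff_map_eq_zero]
  intro x
  induction x using QuotientAddGroup.induction_on with
  | _ a =>
    intro h
    have h' := (QuotientAddGroup.eq_zero_iff (ulmSubMap N.subtype p k a)).1 h
    exact (QuotientAddGroup.eq_zero_iff _).2 (ulm_restrict hp N hN (k + 1) a.1 h')

theorem ulmMap_exact {p : ℕ} (hp : p.Prime) {G : Type u} [AddCommGroup G]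
    (N : AddSubgroup G) (hN : IsPureSubgroup N) (k : ℕ) :
    Exact (ulmMap N.subtype p k) (ulmMap (QuotientAddGroup.mk' N) p k) := by
  intro x
  constructor
  · induction x using QuotientAddGroup.induction_on with
    | _ a =>
      intro h
      have h' : QuotientAddGroup.mk' N a ∈ ulmSub (G ⧸ N) p (k + 1) :=
        (QuotientAddGroup.eq_zero_iff (ulmSubMap (QuotientAddGroup.mk' N) p k a)).1 h
      obtain ⟨y, hy, e⟩ := ulm_lift hp N hN (k + 1) _ h'
      have hm : -y + (a : G) ∈ N := QuotientAddGroup.eq.1 e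
      have hb := ulm_restrict hp N hN k ⟨_, hm⟩
        (add_mem (neg_mem (ulmSub_succ_le p k y hy)) a.2)
      refine ⟨QuotientAddGroup.mk ⟨⟨_, hm⟩, hb⟩, ?_⟩
      refine QuotientAddGroup.eq.2 ?_
      change -(-y + (a : G)) + a ∈ ulmSub G p (k + 1)
      simpa using hy
  · rintro ⟨z, rfl⟩
    induction z using QuotientAddGroup.induction_on with
    | _ a =>
      refine (QuotientAddGroup.eq_zero_iff
        (ulmSubMap (QuotientAddGroup.mk' N) p k (ulmSubMap N.subtype p k a))).2 ?_
      change QuotientAddGroup.mk' N (a : N) ∈ ulmSub (G ⧸ N) p (k + 1)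
      have : QuotientAddGroup.mk' N ((a : N) : G) = 0 :=
        (QuotientAddGroup.eq_zero_iff _).2 (a : N).2
      rw [this]
      exact zero_mem _

theorem rank_eq_of_exact_zmod {p : ℕ} (hp : p.Prime) {A B C : Type u}
    [AddCommGroup A] [AddCommGroup B] [AddCommGroup C]
    [Module (ZMod p) A] [Module (ZMod p) B] [Module (ZMod p) C]
    (a : A →+ B) (b : B →+ C) (ha : Injective a) (hb : Surjective b) (hab : Exact a b) :
    Module.rank (ZMod p) B = Module.rank (ZMod p) C + Module.rank (ZMod p) A := by
  have : Fact p.Prime := ⟨hp⟩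
  let g := b.toZModLinearMap p
  let f := a.toZModLinearMap p
  have hf : Injective f := ha
  have hg : Surjective g := hb
  have hfg : Exact f g := hab
  have h1 := LinearMap.rank_range_add_rank_ker g
  have h2 : Module.rank (ZMod p) (LinearMap.range f) = Module.rank (ZMod p) A :=
    rank_range_of_injective f hf
  rw [rank_range_of_surjective g hg, LinearMap.exact_iff.1 hfg, h2] at h1
  exact h1.symm

/-- For a pure subgroup `N ≤ G` the Ulm invariants satisfy
`f_k(G) = f_k(G/N) + f_k(N)` as cardinals. -/
theorem ulmInvariant_of_pure (p : ℕ) (hp : p.Prime) (G : Type u) [AddCommGroup G]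
    (N : AddSubgroup G) (hN : IsPureSubgroup N) (k : ℕ) :
    UlmInvariant G p k = UlmInvariant (G ⧸ N) p k + UlmInvariant ↥N p k := by
  exact @rank_eq_of_exact_zmod p hp (UlmQuot N p k) (UlmQuot G p k) (UlmQuot (G ⧸ N) p k) _ _ _
    (AddCommGroup.zmodModule (UlmQuot_nsmul N p k))
    (AddCommGroup.zmodModule (UlmQuot_nsmul G p k))
    (AddCommGroup.zmodModule (UlmQuot_nsmul (G ⧸ N) p k))
    (ulmMap N.subtype p k) (ulmMap (QuotientAddGroup.mk' N) p k)
    (ulmMap_injective hp N hN k) (ulmMap_surjective hp N hN k) (ulmMap_exact hp N hN k)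
end

section
/- Let p be a prime and G an abelian p-group. The following are equivalent: (a) G is weakly Hopfian; (b) the Ulm invariant f_k(G) is finite for every natural number k, and the maximal divisible subgroup of G has finite p-rank; (c) G is directly finite. -/
open Function

universe u

section Aux

/-- A retract with a non-injective split surjection contradicts direct finiteness. -/
theorem aux_not_directlyFinite {G : Type u} [AddCommGroup G] (α β : G →+ G)
    (h : ∀ x, α (β x) = x) (m : G) (hm : m ≠ 0) (hαm : α m = 0) : ¬ DirectlyFinite G := by
  intro hD
  let e : G ≃+ G × α.ker :=
    { toFun := fun x => (α x, ⟨x - β (α x), by simp [AddMonoidHom.mem_ker, h]⟩)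
      invFun := fun y => β y.1 + y.2
      left_inv := by intro x; simp
      right_inv := by
        rintro ⟨y, ⟨z, hz⟩⟩
        have hz' : α z = 0 := hz
        ext <;> simp [h, hz']
      map_add' := by
        intro x y
        ext
        · simp
        · simp only [map_add, Prod.mk_add_mk, AddMemClass.mk_add_mk]
          abel }
  have := hD _ e
  have h2 := Subsingleton.elim (⟨m, hαm⟩ : α.ker) 0
  exact hm (congrArg Subtype.val h2)

theorem aux_retract {G : Type u} [AddCommGroup G] {M : Type*} [AddCommGroup M]
    (i : M →+ G) (r : G →+ M) (hri : ∀ x, r (i x) = x) (s t : M →+ M)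
    (hst : ∀ x, s (t x) = x) (m : M) (hm : m ≠ 0) (hsm : s m = 0) : ¬ DirectlyFinite G := by
  refine aux_not_directlyFinite
    (AddMonoidHom.id G - i.comp r + i.comp (s.comp r))
    (AddMonoidHom.id G - i.comp r + i.comp (t.comp r)) ?_ (i m) ?_ ?_
  · intro x
    simp [hri, hst]
  · intro h
    apply hm
    rw [← hri m, h, map_zero]
  · simp [hri, hsm]

theorem aux_shift (R : Type*) [Ring R] [Nontrivial R] (ι : Type*) [Infinite ι] :
    ∃ s t : (ι →₀ R) →+ (ι →₀ R), (∀ x, s (t x) = x) ∧ ∃ m, m ≠ 0 ∧ s m = 0 := by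
  obtain ⟨e⟩ : Nonempty (ι ≃ Option ι) := by
    apply Cardinal.eq.1
    rw [Cardinal.mk_option]
    exact (Cardinal.add_one_of_aleph0_le (Cardinal.aleph0_le_mk ι)).symm
  let f : ι → ι := fun i => e.symm (some i)
  have hf : Injective f := e.symm.injective.comp (Option.some_injective _)
  refine ⟨(Finsupp.lcomapDomain (R := R) (M := R) f hf).toAddMonoidHom,
    (Finsupp.lmapDomain R R f).toAddMonoidHom, ?_, Finsupp.single (e.symm none) 1, ?_, ?_⟩
  · intro x
    exact Finsupp.leftInverse_lcomapDomain_mapDomain (R := R) f hf x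
  · simp
  · ext i
    simp [f]

theorem aux_zmod_dvd (n : ℕ) [NeZero n] (a c : ZMod n) (h : ∀ b : ZMod n, b * a = 0 → b * c = 0) :
    ∃ d, c = a * d := by
  have hn : n ≠ 0 := NeZero.ne n
  obtain ⟨q, hq⟩ := Nat.gcd_dvd_left n a.val
  obtain ⟨r, hr⟩ := Nat.gcd_dvd_right n a.val
  set g := Nat.gcd n a.val with hg
  have hq0 : q ≠ 0 := by rintro rfl; simp at hq; exact hn hq
  have h1 : (q : ZMod n) * a = 0 := by
    have : (q : ZMod n) * a = ((q * a.val : ℕ) : ZMod n) := by simp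
    rw [this, hr, ← mul_assoc, mul_comm q g, ← hq]
    simp
  have h2 := h _ h1
  have h3 : (q : ZMod n) * c = ((q * c.val : ℕ) : ZMod n) := by simp
  rw [h3, ZMod.natCast_eq_zero_iff] at h2
  replace h2 : q * g ∣ q * c.val := by
    rw [mul_comm q g, ← hq]; exact h2
  obtain ⟨u, hu⟩ := Nat.dvd_of_mul_dvd_mul_left (Nat.pos_of_ne_zero hq0) h2
  have hb := Nat.gcd_eq_gcd_ab n a.val
  refine ⟨(Nat.gcdB n a.val : ZMod n) * u, ?_⟩
  have h4 : ((g : ℕ) : ZMod n) = a * (Nat.gcdB n a.val : ZMod n) := by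
    have := congrArg (Int.cast : ℤ → ZMod n) hb
    simpa using this
  have h5 : c = ((c.val : ℕ) : ZMod n) := by simp
  rw [h5, hu]
  push_cast
  rw [h4]; ring

theorem aux_baer (n : ℕ) [NeZero n] (ι : Type*) : Module.Baer (ZMod n) (ι →₀ ZMod n) := by
  intro I g
  have : IsPrincipalIdealRing (ZMod n) :=
    IsPrincipalIdealRing.of_surjective (Int.castRingHom (ZMod n)) ZMod.intCast_surjective
  obtain ⟨a, ha⟩ := (IsPrincipalIdealRing.principal I).principal
  have haI : a ∈ I := by rw [ha]; exact Submodule.mem_span_singleton_self a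
  set m := g ⟨a, haI⟩ with hm
  have key : ∀ c : ZMod n, ∃ d, ((∀ b : ZMod n, b * a = 0 → b * c = 0) → c = a * d) ∧
      (c = 0 → d = 0) := by
    intro c
    by_cases hc : c = 0
    · exact ⟨0, by simp [hc]⟩
    · by_cases h : ∀ b : ZMod n, b * a = 0 → b * c = 0
      · obtain ⟨d, hd⟩ := aux_zmod_dvd n a c h
        exact ⟨d, fun _ => hd, fun h => absurd h hc⟩
      · exact ⟨0, fun h' => absurd h' h, fun _ => rfl⟩
  choose F hF1 hF0 using key
  let m' : ι →₀ ZMod n := m.mapRange F (hF0 0 rfl)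
  have hmm : m = a • m' := by
    ext i
    simp only [m', Finsupp.smul_apply, Finsupp.mapRange_apply, smul_eq_mul]
    apply hF1
    intro b hb
    have : b • m = 0 := by
      rw [hm, ← map_smul]
      have : b • (⟨a, haI⟩ : I) = 0 := Subtype.ext hb
      rw [this, map_zero]
    simpa using DFunLike.congr_fun this i
  refine ⟨LinearMap.toSpanSingleton _ _ m', ?_⟩
  intro x hx
  have hx' := hx
  rw [ha] at hx'
  obtain ⟨c, rfl⟩ := Submodule.mem_span_singleton.1 hx'
  have : (⟨c • a, hx⟩ : I) = c • ⟨a, haI⟩ := rfl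
  rw [this, LinearMap.map_smul g, ← hm, hmm]
  simp [mul_smul]

/-- Divisibility of a `p`-subgroup can be tested on `p`. -/
theorem aux_divisible {p : ℕ} {G : Type u} [AddCommGroup G] (hp : p.Prime)
    (hG : IsPAddGroup G p) (H : AddSubgroup G) (h : ∀ x ∈ H, ∃ y ∈ H, p • y = x) :
    IsDivisibleSubgroup H := by
  intro n
  induction n using Nat.recOnMul with
  | zero => intro h; omega
  | one => intro _ x hx; exact ⟨x, hx, one_smul _ _⟩
  | prime q hq =>
    intro _ x hx
    by_cases hqp : q = p
    · subst hqp; exact h x hx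
    · obtain ⟨a, ha⟩ := hG x
      have hc : Nat.Coprime q (p ^ a) := Nat.Coprime.pow_right a ((Nat.coprime_primes hq hp).2 hqp)
      have hb := Nat.gcd_eq_gcd_ab q (p ^ a)
      rw [hc.gcd_eq_one] at hb
      refine ⟨Nat.gcdA q (p ^ a) • x, H.zsmul_mem hx _, ?_⟩
      have h1 : ((1 : ℕ) : ℤ) • x = x := by simp
      rw [hb, add_smul, mul_smul, mul_comm ((p ^ a : ℕ) : ℤ), mul_smul, natCast_zsmul,
        natCast_zsmul, ha, smul_zero, add_zero] at h1
      exact h1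
  | mul a b iha ihb =>
    intro hab x hx
    have ha : 0 < a := Nat.pos_of_mul_pos_right hab
    have hb : 0 < b := Nat.pos_of_mul_pos_left hab
    obtain ⟨y, hy, rfl⟩ := iha ha x hx
    obtain ⟨z, hz, rfl⟩ := ihb hb y hy
    exact ⟨z, hz, mul_smul _ _ _⟩

/-- A `p`-subgroup whose socle has infinite heights is divisible. -/
theorem aux_divisible_of_socle {p : ℕ} {G : Type u} [AddCommGroup G] (hp : p.Prime)
    (hG : IsPAddGroup G p) (H : AddSubgroup G)
    (h : ∀ x ∈ H, p • x = 0 → ∀ k : ℕ, ∃ y ∈ H, p ^ k • y = x) :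
    IsDivisibleSubgroup H := by
  apply aux_divisible hp hG
  have : ∀ n : ℕ, ∀ x ∈ H, p ^ n • x = 0 → ∃ y ∈ H, p • y = x := by
    intro n
    induction n with
    | zero => intro x hx h0; exact ⟨0, H.zero_mem, by simpa using h0.symm⟩
    | succ n ih =>
      intro x hx h0
      obtain ⟨y, hy, hyx⟩ := h (p ^ n • x) (H.nsmul_mem hx _)
        (by rw [← mul_smul, ← pow_succ', h0]) (n + 1)
      obtain ⟨z, hz, hzx⟩ := ih (x - p • y) (H.sub_mem hx (H.nsmul_mem hy _))
        (by rw [smul_sub, ← mul_smul, ← pow_succ, hyx, sub_self])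
      exact ⟨z + y, H.add_mem hz hy, by rw [smul_add, hzx]; abel⟩
  intro x hx
  obtain ⟨n, hn⟩ := hG x
  exact this n x hx hn

theorem aux_maxDivisible (G : Type u) [AddCommGroup G] : IsDivisibleSubgroup (maxDivisible G) := by
  intro n hn x hx
  have : maxDivisible G ≤ (maxDivisible G).map (nsmulHom G n) := by
    refine sSup_le ?_
    intro H hH y hy
    obtain ⟨z, hz, hzy⟩ := hH n hn y hy
    exact ⟨z, (le_sSup hH : H ≤ maxDivisible G) hz, hzy⟩
  obtain ⟨y, hy, hyx⟩ := this hx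
  exact ⟨y, hy, hyx⟩

theorem aux_fin {p : ℕ} (hp : p.Prime) (V : Type*) [AddCommGroup V] [Module (ZMod p) V]
    (h : Module.rank (ZMod p) V < Cardinal.aleph0) : Finite V := by
  have := Fact.mk hp
  have h' : Module.Finite (ZMod p) V := Module.rank_lt_aleph0_iff.1 h
  exact Module.finite_of_finite (ZMod p)

theorem aux_seq {p : ℕ} (hp : p.Prime) (V : Type*) [AddCommGroup V] [Module (ZMod p) V]
    (h : ¬ Module.rank (ZMod p) V < Cardinal.aleph0) :
    ∃ v : ℕ → V, ∀ (S : Finset ℕ) (w : ℕ → ℤ), ∑ n ∈ S, w n • v n = 0 →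
      ∀ n ∈ S, (p : ℤ) ∣ w n := by
  have := Fact.mk hp
  let b := Module.Basis.ofVectorSpace (ZMod p) V
  rw [← b.mk_eq_rank'', not_lt, Cardinal.aleph0_le_mk_iff] at h
  let em := Infinite.natEmbedding (Module.Basis.ofVectorSpaceIndex (ZMod p) V)
  have hv : LinearIndependent (ZMod p) (fun n => b (em n)) :=
    b.linearIndependent.comp _ em.injective
  refine ⟨fun n => b (em n), fun S w hw n hn => ?_⟩
  have h4 := linearIndependent_iff'.1 hv S (fun n => ((w n : ℤ) : ZMod p)) (by
    rw [← hw]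
    refine Finset.sum_congr rfl fun n _ => ?_
    rw [Int.cast_smul_eq_zsmul])
  exact (ZMod.intCast_zmod_eq_zero_iff_dvd _ _).1 (h4 n hn)

theorem aux_shiftV {p : ℕ} (hp : p.Prime) (V : Type*) [AddCommGroup V] [Module (ZMod p) V]
    (h : ¬ Module.rank (ZMod p) V < Cardinal.aleph0) :
    ∃ s t : V →+ V, (∀ x, s (t x) = x) ∧ ∃ m, m ≠ 0 ∧ s m = 0 := by
  have := Fact.mk hp
  let b := Module.Basis.ofVectorSpace (ZMod p) V
  rw [← b.mk_eq_rank'', not_lt, Cardinal.aleph0_le_mk_iff] at h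
  obtain ⟨s, t, hst, m, hm, hsm⟩ := aux_shift (ZMod p)
    (Module.Basis.ofVectorSpaceIndex (ZMod p) V)
  let e := b.repr.toAddEquiv
  refine ⟨e.symm.toAddMonoidHom.comp (s.comp e.toAddMonoidHom),
    e.symm.toAddMonoidHom.comp (t.comp e.toAddMonoidHom), ?_, e.symm m, ?_, ?_⟩
  · intro x
    change e.symm (s (e (e.symm (t (e x))))) = x
    rw [e.apply_symm_apply, hst, e.symm_apply_apply]
  · rwa [Ne, AddEquiv.map_eq_zero_iff]
  · change e.symm (s (e (e.symm m))) = 0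
    rw [e.apply_symm_apply, hsm, map_zero]

theorem aux_ulm_finite {p : ℕ} (hp : p.Prime) (G : Type u) [AddCommGroup G] (k : ℕ)
    (h : UlmInvariant G p k < Cardinal.aleph0) : Finite (UlmQuot G p k) :=
  letI : Module (ZMod p) (UlmQuot G p k) := AddCommGroup.zmodModule (UlmQuot_nsmul G p k)
  aux_fin hp (UlmQuot G p k) h

theorem aux_rank_finite {p : ℕ} (hp : p.Prime) (G : Type u) [AddCommGroup G]
    (h : pRank G p < Cardinal.aleph0) : Finite (torsionSub G p) :=
  letI : Module (ZMod p) (torsionSub G p) := AddCommGroup.zmodModule (torsionSub_nsmul G p)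
  aux_fin hp (torsionSub G p) h

theorem aux_ulm_seq {p : ℕ} (hp : p.Prime) (G : Type u) [AddCommGroup G] (k : ℕ)
    (h : ¬ UlmInvariant G p k < Cardinal.aleph0) :
    ∃ v : ℕ → UlmQuot G p k, ∀ (S : Finset ℕ) (w : ℕ → ℤ), ∑ n ∈ S, w n • v n = 0 →
      ∀ n ∈ S, (p : ℤ) ∣ w n :=
  letI : Module (ZMod p) (UlmQuot G p k) := AddCommGroup.zmodModule (UlmQuot_nsmul G p k)
  aux_seq hp (UlmQuot G p k) h

theorem aux_rank_shift {p : ℕ} (hp : p.Prime) (G : Type u) [AddCommGroup G]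
    (h : ¬ pRank G p < Cardinal.aleph0) :
    ∃ s t : torsionSub G p →+ torsionSub G p, (∀ x, s (t x) = x) ∧ ∃ m, m ≠ 0 ∧ s m = 0 :=
  letI : Module (ZMod p) (torsionSub G p) := AddCommGroup.zmodModule (torsionSub_nsmul G p)
  aux_shiftV hp (torsionSub G p) h

theorem aux_b_a {p : ℕ} (hp : p.Prime) (G : Type u) [AddCommGroup G] (hG : IsPAddGroup G p)
    (h1 : ∀ k : ℕ, UlmInvariant G p k < Cardinal.aleph0)
    (h2 : pRank ↥(maxDivisible G) p < Cardinal.aleph0) : WeaklyHopfian G := by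
  intro φ hφ hpure
  have hmap : ∀ k, ∀ x ∈ ulmSub G p k, φ x ∈ ulmSub G p k := by
    rintro k x ⟨⟨g, hg⟩, hx⟩
    have hg' : p ^ k • g = x := hg
    have hx' : p • x = 0 := hx
    refine ⟨⟨φ g, ?_⟩, ?_⟩
    · change p ^ k • φ g = φ x
      rw [← hg', map_nsmul]
    · change p • φ x = 0
      rw [← map_nsmul, hx', map_zero]
  have hsurj : ∀ k, ∀ y ∈ ulmSub G p k, ∃ x ∈ ulmSub G p k, φ x = y := by
    rintro k y ⟨⟨g, hg⟩, hy⟩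
    have hg' : p ^ k • g = y := hg
    have hy' : p • y = 0 := hy
    obtain ⟨h, rfl⟩ := hφ g
    obtain ⟨z, hz, hzh⟩ := hpure (p ^ (k + 1)) (pow_pos hp.pos _) (p ^ (k + 1) • h)
      (by
        change φ _ = 0
        rw [map_nsmul, pow_succ', mul_smul, hg', hy']) ⟨h, rfl⟩
    have hz' : φ z = 0 := hz
    refine ⟨p ^ k • (h - z), ⟨⟨h - z, rfl⟩, ?_⟩, ?_⟩
    · change p • (p ^ k • (h - z)) = 0
      rw [← mul_smul, ← pow_succ', smul_sub, hzh, sub_self]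
    · rw [map_nsmul, map_sub, hz', sub_zero, hg']
  have hstep : ∀ k, ∀ x ∈ ulmSub G p k, φ x = 0 → x ∈ ulmSub G p (k + 1) := by
    intro k x hx h0
    have hfin := aux_ulm_finite hp G k (h1 k)
    let f0 : ulmSub G p k →+ ulmSub G p k :=
      (φ.comp (ulmSub G p k).subtype).codRestrict _ (fun x => hmap k x x.2)
    let f : UlmQuot G p k →+ UlmQuot G p k :=
      QuotientAddGroup.map _ _ f0 (by
        intro y hy
        exact hmap (k + 1) _ hy)
    have hf : Surjective f := by
      intro y
      obtain ⟨y, rfl⟩ := QuotientAddGroup.mk_surjective y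
      obtain ⟨x, hx, hxy⟩ := hsurj k y y.2
      refine ⟨QuotientAddGroup.mk ⟨x, hx⟩, ?_⟩
      change QuotientAddGroup.mk (f0 ⟨x, hx⟩) = _
      congr 1
      exact Subtype.ext hxy
    have hinj : Injective f := Finite.injective_iff_surjective.2 hf
    have h3 : (QuotientAddGroup.mk ⟨x, hx⟩ : UlmQuot G p k) = 0 := by
      apply hinj
      rw [map_zero]
      change QuotientAddGroup.mk (f0 ⟨x, hx⟩) = _
      have : f0 ⟨x, hx⟩ = 0 := Subtype.ext h0
      rw [this]; rfl
    exact (QuotientAddGroup.eq_zero_iff (⟨x, hx⟩ : ulmSub G p k)).1 h3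
  have hall : ∀ x, p • x = 0 → φ x = 0 → ∀ k, x ∈ ulmSub G p k := by
    intro x hx h0 k
    induction k with
    | zero => exact ⟨⟨x, by change p ^ 0 • x = x; simp⟩, hx⟩
    | succ k ih => exact hstep k x ih h0
  have hKdiv : IsDivisibleSubgroup φ.ker := by
    apply aux_divisible_of_socle hp hG
    intro x hx hpx k
    obtain ⟨⟨g, hg⟩, -⟩ := hall x hpx hx k
    exact hpure (p ^ k) (pow_pos hp.pos _) x hx ⟨g, hg⟩
  have hKD : φ.ker ≤ maxDivisible G := le_sSup hKdiv
  have hDD := aux_maxDivisible G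
  have hpre : (maxDivisible G).comap φ ≤ maxDivisible G := by
    refine le_sSup ?_
    intro n hn x hx
    obtain ⟨y, hy, hyx⟩ := hDD n hn (φ x) hx
    obtain ⟨y, rfl⟩ := hφ y
    obtain ⟨z, hz, hzx⟩ := hKdiv n hn (x - n • y) (by
      change φ _ = 0
      rw [map_sub, map_nsmul, hyx, sub_self])
    have hz' : φ z = 0 := hz
    refine ⟨z + y, ?_, ?_⟩
    · change φ (z + y) ∈ maxDivisible G
      rw [map_add, hz', zero_add]; exact hy
    · rw [smul_add, hzx]; abel
  have himg : ∀ x ∈ maxDivisible G, φ x ∈ maxDivisible G := by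
    intro x hx
    have : (maxDivisible G).map φ ≤ maxDivisible G := by
      refine le_sSup ?_
      rintro n hn _ ⟨x, hx, rfl⟩
      obtain ⟨y, hy, rfl⟩ := hDD n hn x hx
      exact ⟨φ y, ⟨y, hy, rfl⟩, (map_nsmul _ _ _).symm⟩
    exact this ⟨x, hx, rfl⟩
  have hfin := aux_rank_finite hp _ h2
  let F : torsionSub (maxDivisible G) p → torsionSub (maxDivisible G) p := fun x =>
    ⟨⟨φ x.1.1, himg _ x.1.2⟩, by
      have hx : p • x.1 = 0 := x.2
      have hx' : p • x.1.1 = 0 := congrArg Subtype.val hx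
      apply Subtype.ext
      change p • φ x.1.1 = 0
      rw [← map_nsmul, hx', map_zero]⟩
  have hF : Surjective F := by
    rintro ⟨⟨y, hyD⟩, hy⟩
    have hy' : p • y = 0 := congrArg Subtype.val (show p • (⟨y, hyD⟩ : maxDivisible G) = 0 from hy)
    obtain ⟨x, rfl⟩ := hφ y
    have hxD : x ∈ maxDivisible G := hpre hyD
    obtain ⟨z, hz, hzx⟩ := hKdiv p hp.pos (p • x) (by
      change φ _ = 0
      rw [map_nsmul, hy'])
    have hz' : φ z = 0 := hz
    refine ⟨⟨⟨x - z, AddSubgroup.sub_mem _ hxD (hKD hz)⟩, ?_⟩, ?_⟩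
    · apply Subtype.ext
      change p • (x - z) = 0
      rw [smul_sub, hzx, sub_self]
    · apply Subtype.ext
      apply Subtype.ext
      change φ (x - z) = φ x
      rw [map_sub, hz', sub_zero]
  have hFinj : Injective F := Finite.injective_iff_surjective.2 hF
  have hsoc : ∀ x, φ x = 0 → p • x = 0 → x = 0 := by
    intro x hx hpx
    have hxD : x ∈ maxDivisible G := hKD hx
    have := @hFinj ⟨⟨x, hxD⟩, Subtype.ext hpx⟩ ⟨0, AddSubgroup.zero_mem _⟩ (by
      apply Subtype.ext
      apply Subtype.ext
      change φ x = φ 0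
      rw [hx, map_zero])
    exact congrArg (fun t => t.1.1) this
  rw [injective_iff_map_eq_zero]
  intro x hx
  obtain ⟨n, hn⟩ := hG x
  induction n with
  | zero => simpa using hn
  | succ n ih =>
    apply ih
    apply hsoc
    · rw [map_nsmul, hx, smul_zero]
    · rw [← mul_smul, ← pow_succ', hn]

theorem aux_a_c (G : Type u) [AddCommGroup G] (h : WeaklyHopfian G) : DirectlyFinite G := by
  intro A _ e
  have hinj := h ((AddMonoidHom.fst G A).comp e.toAddMonoidHom) (by
    intro g
    exact ⟨e.symm (g, 0), by simp⟩) (by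
    rintro n hn x hx ⟨g, rfl⟩
    have hx' : (e (n • g)).1 = 0 := hx
    refine ⟨e.symm (0, (e g).2), ?_, ?_⟩
    · change (e _).1 = 0
      simp
    · apply e.injective
      rw [map_nsmul] at hx' ⊢
      rw [AddEquiv.apply_symm_apply, map_nsmul]
      ext
      · simpa using hx'.symm
      · simp)
  constructor
  intro a b
  have := @hinj (e.symm (0, a)) (e.symm (0, b)) (by simp)
  simpa using this

theorem aux_c_ulm {p : ℕ} (hp : p.Prime) (G : Type u) [AddCommGroup G]
    (k : ℕ) (h : ¬ UlmInvariant G p k < Cardinal.aleph0) :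
    ∃ g : ℕ → G, (∀ n, p ^ (k + 1) • g n = 0) ∧
      ∀ w : ℕ →₀ ℤ, (∑ n ∈ w.support, w n • p ^ k • g n) ∈ smulSub G (p ^ (k + 1)) →
        ∀ n, (p : ℤ) ∣ w n := by
  obtain ⟨v, hv⟩ := aux_ulm_seq hp G k h
  have hx : ∀ n, ∃ x : ulmSub G p k, QuotientAddGroup.mk x = v n :=
    fun n => QuotientAddGroup.mk_surjective _
  choose x hx using hx
  have hg : ∀ n, ∃ g : G, p ^ k • g = x n := fun n => (x n).2.1
  choose g hg using hg
  refine ⟨g, ?_, ?_⟩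
  · intro n
    rw [pow_succ', mul_smul, hg]
    exact (x n).2.2
  · intro w hw n
    have h1 : ((∑ n ∈ w.support, w n • x n : ulmSub G p k) : G) =
        ∑ n ∈ w.support, w n • p ^ k • g n := by
      simp [hg]
    have h2 : (QuotientAddGroup.mk (∑ n ∈ w.support, w n • x n) : UlmQuot G p k) = 0 := by
      rw [QuotientAddGroup.eq_zero_iff, AddSubgroup.mem_addSubgroupOf]
      refine ⟨?_, (∑ n ∈ w.support, w n • x n : ulmSub G p k).2.2⟩
      rw [h1]; exact hw
    have h3 : ∑ n ∈ w.support, w n • v n = 0 := by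
      rw [← h2]
      change _ = QuotientAddGroup.mk' _ _
      rw [map_sum]
      refine Finset.sum_congr rfl fun n _ => ?_
      rw [map_zsmul, ← hx n]
      rfl
    by_cases hn : n ∈ w.support
    · exact hv _ _ h3 n hn
    · simp [Finsupp.notMem_support_iff.1 hn]

theorem aux_c_b1 {p : ℕ} (hp : p.Prime) (G : Type u) [AddCommGroup G] (hD : DirectlyFinite G)
    (k : ℕ) : UlmInvariant G p k < Cardinal.aleph0 := by
  by_contra h
  obtain ⟨g, hg1, hg2⟩ := aux_c_ulm hp G k h
  have : Fact (1 < p ^ (k + 1)) := ⟨Nat.one_lt_pow (by omega) hp.one_lt⟩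
  have hne : NeZero (p ^ (k + 1)) := ⟨(pow_pos hp.pos _).ne'⟩
  obtain ⟨s, t, hst, m, hm, hsm⟩ := aux_shift (ZMod (p ^ (k + 1))) ℕ
  let c : ℕ → (ZMod (p ^ (k + 1)) →+ G) := fun n =>
    ZMod.lift (p ^ (k + 1)) ⟨zmultiplesHom G (g n), by simp [← hg1 n, ← natCast_zsmul]⟩
  have hc : ∀ n (z : ℤ), c n (z : ZMod (p ^ (k + 1))) = z • g n := by
    intro n z
    simp [c]
  let i : (ℕ →₀ ZMod (p ^ (k + 1))) →+ G := Finsupp.liftAddHom c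
  let Q := G ⧸ smulSub G (p ^ (k + 1))
  let _ : Module (ZMod (p ^ (k + 1))) Q := AddCommGroup.zmodModule (by
    intro x
    obtain ⟨x, rfl⟩ := QuotientAddGroup.mk_surjective x
    rw [← QuotientAddGroup.mk_nsmul, QuotientAddGroup.eq_zero_iff]
    exact ⟨x, rfl⟩)
  let π : G →+ Q := QuotientAddGroup.mk' _
  have hker : ∀ m, π (i m) = 0 → p • m = 0 → m = 0 := by
    intro m hm hpm
    have hz : ∀ y : ZMod (p ^ (k + 1)), ∃ z : ℤ, (p • y = 0 → y = ((p ^ k * z : ℤ) : ZMod _)) ∧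
        (y = 0 → z = 0) := by
      intro y
      by_cases hy0 : y = 0
      · exact ⟨0, by simp [hy0]⟩
      by_cases hy : p • y = 0
      · have h1 : y = ((y.val : ℕ) : ZMod _) := by simp
        rw [h1, nsmul_eq_mul, ← Nat.cast_mul, ZMod.natCast_eq_zero_iff] at hy
        replace hy : p * p ^ k ∣ p * y.val := by rw [← pow_succ']; exact hy
        obtain ⟨u, hu⟩ := Nat.dvd_of_mul_dvd_mul_left hp.pos hy
        refine ⟨u, fun _ => ?_, fun h => absurd h hy0⟩
        rw [h1, hu]; push_cast; rfl
      · exact ⟨0, fun h => absurd h hy, fun _ => rfl⟩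
    choose Z hZ hZ0 using hz
    let w : ℕ →₀ ℤ := m.mapRange Z (hZ0 0 rfl)
    have hmw : ∀ n, m n = ((p ^ k * w n : ℤ) : ZMod _) := fun n =>
      hZ _ (by simpa using DFunLike.congr_fun hpm n)
    have hsupp : m.support = w.support := by
      ext n
      rw [Finsupp.mem_support_iff, Finsupp.mem_support_iff, not_iff_not]
      constructor
      · intro h; simp only [w, Finsupp.mapRange_apply]; exact hZ0 _ h
      · intro h; rw [hmw, h]; simp
    have him : i m = ∑ n ∈ w.support, w n • p ^ k • g n := by
      simp only [i, Finsupp.liftAddHom_apply, Finsupp.sum]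
      rw [hsupp]
      refine Finset.sum_congr rfl fun n _ => ?_
      rw [hmw, hc, mul_comm, mul_smul, ← natCast_zsmul]
      push_cast; rfl
    have := hg2 w (by rw [← him]; exact (QuotientAddGroup.eq_zero_iff _).1 hm)
    ext n
    obtain ⟨v, hv⟩ := this n
    rw [hmw, hv, Finsupp.zero_apply, ZMod.intCast_zmod_eq_zero_iff_dvd]
    exact ⟨v, by push_cast; ring⟩
  have hinj : Injective (π.comp i) := by
    rw [injective_iff_map_eq_zero]
    intro m hm
    have h0 : p ^ (k + 1) • m = 0 := by
      ext n
      simp only [Finsupp.smul_apply, nsmul_eq_mul, CharP.cast_eq_zero, zero_mul,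
        Finsupp.zero_apply]
    obtain ⟨a, ha⟩ : ∃ a, p ^ a • m = 0 := ⟨_, h0⟩
    clear h0
    induction a with
    | zero => simpa using ha
    | succ a ih =>
      apply ih
      apply hker
      · have hm' : π (i m) = 0 := hm
        rw [map_nsmul, map_nsmul, hm', smul_zero]
      · rw [← mul_smul, ← pow_succ', ha]
  obtain ⟨r, hr⟩ := (aux_baer (p ^ (k + 1)) ℕ).extension_property
    ((π.comp i).toZModLinearMap (p ^ (k + 1))) hinj LinearMap.id
  exact aux_retract i (r.toAddMonoidHom.comp π) (fun x => LinearMap.congr_fun hr x)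
    s t hst m hm hsm hD

theorem aux_c_b2 {p : ℕ} (hp : p.Prime) (G : Type u) [AddCommGroup G] (hG : IsPAddGroup G p)
    (hD : DirectlyFinite G) : pRank ↥(maxDivisible G) p < Cardinal.aleph0 := by
  by_contra h
  let D := maxDivisible G
  have hDD : IsDivisibleSubgroup D := aux_maxDivisible G
  let V := torsionSub D p
  obtain ⟨s', t', hst', m, hm, hsm⟩ := aux_rank_shift hp D h
  have hdiv : ∀ n : ℕ, 0 < n → ∀ x : D, ∃ y : D, n • y = x := by
    rintro n hn ⟨x, hx⟩
    obtain ⟨y, hy, hyx⟩ := hDD n hn x hx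
    exact ⟨⟨y, hy⟩, Subtype.ext hyx⟩
  let _ : DivisibleBy D ℕ := divisibleByOfSMulRightSurj D ℕ (by
    intro n hn x
    exact hdiv n (Nat.pos_of_ne_zero hn) x)
  let _ : DivisibleBy D ℤ := AddGroup.divisibleByIntOfDivisibleByNat D
  have hB : Module.Baer ℤ D := Module.Baer.of_divisible D
  obtain ⟨r, hr⟩ := hB.extension_property_addMonoidHom D.subtype Subtype.val_injective
    (AddMonoidHom.id D)
  obtain ⟨σ, hσ⟩ := hB.extension_property_addMonoidHom V.subtype Subtype.val_injective
    (V.subtype.comp s')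
  obtain ⟨τ, hτ⟩ := hB.extension_property_addMonoidHom V.subtype Subtype.val_injective
    (V.subtype.comp t')
  have hσ' : ∀ v : V, σ v = s' v := fun v => DFunLike.congr_fun hσ v
  have hτ' : ∀ v : V, τ v = t' v := fun v => DFunLike.congr_fun hτ v
  have hid : ∀ v : D, p • v = 0 → σ (τ v) = v := by
    intro v hv
    have := hτ' ⟨v, hv⟩
    rw [show τ v = t' ⟨v, hv⟩ from this, hσ', hst']
  have hDp : ∀ x : D, ∃ n : ℕ, p ^ n • x = 0 := by
    intro x
    obtain ⟨n, hn⟩ := hG x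
    exact ⟨n, Subtype.ext hn⟩
  have hbinj : Injective (σ.comp τ) := by
    rw [injective_iff_map_eq_zero]
    intro x hx
    obtain ⟨n, hn⟩ := hDp x
    induction n with
    | zero => simpa using hn
    | succ n ih =>
      apply ih
      have h1 : p • (p ^ n • x) = 0 := by rw [← mul_smul, ← pow_succ', hn]
      rw [← hid _ h1]
      change (σ.comp τ) _ = 0
      rw [map_nsmul, hx, smul_zero]
  have hbsurj : Surjective (σ.comp τ) := by
    have : ∀ n : ℕ, ∀ x : D, p ^ n • x = 0 → ∃ y, σ.comp τ y = x := by
      intro n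
      induction n with
      | zero => intro x hx; exact ⟨0, by simpa using hx.symm⟩
      | succ n ih =>
        intro x hx
        obtain ⟨y, hy⟩ := hdiv (p ^ n) (pow_pos hp.pos _) (p ^ n • x)
        have h1 : σ (τ (p ^ n • x)) = p ^ n • x :=
          hid _ (by rw [← mul_smul, ← pow_succ', hx])
        obtain ⟨z, hz⟩ := ih (x - σ.comp τ x) (by
          rw [smul_sub, ← map_nsmul]
          change _ - σ (τ (p ^ n • x)) = 0
          rw [h1, sub_self])
        exact ⟨z + x, by rw [map_add, hz]; abel⟩
    intro x
    obtain ⟨n, hn⟩ := hDp x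
    exact this n x hn
  let e : D ≃+ D := AddEquiv.ofBijective (σ.comp τ) ⟨hbinj, hbsurj⟩
  have he : ∀ x, e x = σ (τ x) := fun x => rfl
  refine aux_retract D.subtype r (fun x => DFunLike.congr_fun hr x)
    (e.symm.toAddMonoidHom.comp σ) τ ?_ (m : D) ?_ ?_ hD
  · intro x
    change e.symm (σ (τ x)) = x
    rw [← he, AddEquiv.symm_apply_apply]
  · intro h0
    exact hm (Subtype.ext h0)
  · change e.symm (σ _) = 0
    rw [hσ', hsm]
    simp

end Aux

/-- For a `p`-group `G`: weakly Hopfian ↔ all finite Ulm invariants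
are finite and the maximal divisible subgroup has finite `p`-rank ↔ directly finite. -/
theorem weaklyHopfian_iff_ulm_finite_iff_directlyFinite (p : ℕ) (hp : p.Prime)
    (G : Type u) [AddCommGroup G] (hG : IsPAddGroup G p) :
    (WeaklyHopfian G ↔
        ((∀ k : ℕ, UlmInvariant G p k < Cardinal.aleph0) ∧
          pRank ↥(maxDivisible G) p < Cardinal.aleph0)) ∧
    (WeaklyHopfian G ↔ DirectlyFinite G) := by
  have hbc : DirectlyFinite G → ((∀ k : ℕ, UlmInvariant G p k < Cardinal.aleph0) ∧
      pRank ↥(maxDivisible G) p < Cardinal.aleph0) := fun h =>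
    ⟨fun k => aux_c_b1 hp G h k, aux_c_b2 hp G hG h⟩
  exact ⟨⟨fun h => hbc (aux_a_c G h), fun h => aux_b_a hp G hG h.1 h.2⟩,
    ⟨aux_a_c G, fun h => aux_b_a hp G hG (hbc h).1 (hbc h).2⟩⟩
end

section
/- Let p be a prime. Every countable reduced relatively Hopfian abelian p-group is finite. -/
open Function

universe u

/-- Hom onto a cyclic subgroup, killing `L`. -/
theorem rh_lemC {G K : Type*} [AddCommGroup G] [AddCommGroup K] (p : ℕ) (hp : p.Prime)
    (N : ℕ) (hN : 0 < N) (L : AddSubgroup G) (hL : ∀ g : G, p ^ N • g ∈ L) (x : G)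
    (hx : p ^ (N - 1) • x ∉ L) (κ : K) (hκ : p ^ N • κ = 0) :
    ∃ f : G →+ K, f x = κ ∧ (∀ g, f g ∈ AddSubgroup.zmultiples κ) ∧ ∀ g ∈ L, f g = 0 := by
  have hy : (QuotientAddGroup.mk (p ^ (N - 1) • x) : G ⧸ L) ≠ 0 := by
    rwa [Ne, QuotientAddGroup.eq_zero_iff]
  obtain ⟨c, hc⟩ := CharacterModule.exists_character_apply_ne_zero_of_ne_zero hy
  let C : G →+ AddCircle (1 : ℚ) := AddMonoidHom.comp c (QuotientAddGroup.mk' L)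
  have hCx : C (p ^ (N - 1) • x) ≠ 0 := hc
  have hCL : ∀ g ∈ L, C g = 0 := by
    intro g hg
    have : (QuotientAddGroup.mk' L) g = 0 := by
      simpa using hg
    change c ((QuotientAddGroup.mk' L) g) = 0
    rw [this]
    exact map_zero c
  have hpos : 0 < p ^ N := pow_pos hp.pos N
  let u : AddCircle (1 : ℚ) := ((1 / ((p ^ N : ℕ) : ℚ) : ℚ) : AddCircle (1 : ℚ))
  haveI : Fact ((0 : ℚ) < 1) := ⟨one_pos⟩
  have hu : addOrderOf u = p ^ N := AddCircle.addOrderOf_period_div (p := (1 : ℚ)) hpos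
  have hm : ∀ g, ∃ m : ℤ, C g = m • u := by
    intro g
    have h0 : p ^ N • C g = 0 := by
      rw [← map_nsmul]; exact hCL _ (hL g)
    obtain ⟨m, -, hm⟩ := (AddCircle.nsmul_eq_zero_iff hpos).1 h0
    refine ⟨m, ?_⟩
    rw [← hm]
    simp only [u]
    rw [← AddCircle.coe_zsmul]
    congr 1
    simp [div_eq_mul_inv]
  choose m hm using hm
  have hz : ∀ z : ℤ, z • u = 0 → z • κ = 0 := by
    intro z hz
    rw [← addOrderOf_dvd_iff_zsmul_eq_zero, hu] at hz
    obtain ⟨w, rfl⟩ := hz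
    rw [mul_comm, mul_smul, natCast_zsmul, hκ, smul_zero]
  let f0 : G →+ K := AddMonoidHom.mk' (fun g => m g • κ) (by
    intro a b
    have h := hz (m (a + b) - (m a + m b)) (by
      rw [sub_smul, add_smul, ← hm, ← hm, ← hm, map_add, sub_self])
    rw [sub_smul, sub_eq_zero, add_smul] at h
    exact h)
  have hf0 : ∀ g, f0 g = m g • κ := fun g => rfl
  have hnd : ¬ (p : ℤ) ∣ m x := by
    rintro ⟨a, ha⟩
    apply hCx
    rw [map_nsmul, hm, ha, ← natCast_zsmul, smul_smul, ← addOrderOf_dvd_iff_zsmul_eq_zero, hu,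
      ← mul_assoc]
    apply Dvd.dvd.mul_right
    have : p ^ N = p ^ (N - 1) * p := by rw [← pow_succ]; congr 1; omega
    rw [this]; push_cast; rfl
  have hcop : IsCoprime (m x) ((p : ℤ) ^ N) :=
    (((Nat.prime_iff_prime_int.1 hp).coprime_iff_not_dvd).2 hnd).symm.pow_right
  obtain ⟨b, d, hbd⟩ := hcop
  refine ⟨b • f0, ?_, ?_, ?_⟩
  · have h1 : (b * m x) • κ = (1 - d * (p : ℤ) ^ N) • κ := by congr 1; linarith
    have h2 : ((p : ℤ) ^ N) • κ = 0 := by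
      have := natCast_zsmul κ (p ^ N)
      rw [hκ] at this
      exact_mod_cast this
    simp only [AddMonoidHom.smul_apply, hf0, smul_smul]
    rw [h1, sub_smul, mul_smul, h2, smul_zero, sub_zero, one_smul]
  · intro g
    simp only [AddMonoidHom.smul_apply, hf0, smul_smul]
    exact AddSubgroup.zsmul_mem_zmultiples _ _
  · intro g hg
    simp only [AddMonoidHom.smul_apply, hf0]
    rw [hz (m g) (by rw [← hm, hCL g hg]), smul_zero]

/-- Triangular construction of a surjection. -/
theorem rh_lemD {G K : Type*} [AddCommGroup G] [AddCommGroup K] [Countable G] [Countable K]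
    (H : ∀ (S : Finset G) (κ : K), ∃ (f : G →+ K) (x : G), f x = κ ∧
      (∀ g, f g ∈ AddSubgroup.zmultiples κ) ∧ ∀ g ∈ S, f g = 0) :
    ∃ f : G →+ K, Surjective f := by
  classical
  obtain ⟨g, hg⟩ := exists_surjective_nat G
  obtain ⟨κ, hκ⟩ := exists_surjective_nat K
  choose F X hFX hFr hFS using H
  let S : ℕ → Finset G := fun n => Nat.rec ∅ (fun k T => insert (g k) (insert (X T (κ k)) T)) n
  have hS : ∀ k, S (k + 1) = insert (g k) (insert (X (S k) (κ k)) (S k)) := fun k => rfl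
  have hmono : Monotone S := monotone_nat_of_le_succ (fun k => by
    rw [hS]; intro y hy; simp [hy])
  have hfin : ∀ y : G, (support fun k => F (S k) (κ k) y).Finite := by
    intro y
    obtain ⟨i, rfl⟩ := hg y
    refine (Set.finite_le_nat i).subset ?_
    intro k hk
    by_contra hlt
    apply hk
    apply hFS
    have : i + 1 ≤ k := by simpa using hlt
    exact hmono this (by rw [hS]; simp)
  let f : G →+ K := AddMonoidHom.mk' (fun y => ∑ᶠ k, F (S k) (κ k) y) (by
    intro a b
    simp only [map_add]
    exact finsum_add_distrib (hfin a) (hfin b))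
  have key : ∀ k, κ k ∈ f.range := by
    intro k
    induction k using Nat.strong_induction_on with
    | _ k ih =>
    have h1 : f (X (S k) (κ k)) = ∑ j ∈ Finset.range (k + 1), F (S j) (κ j) (X (S k) (κ k)) := by
      change ∑ᶠ j, F (S j) (κ j) (X (S k) (κ k)) = _
      apply finsum_eq_sum_of_support_subset
      intro j hj
      by_contra hlt
      apply hj
      apply hFS
      have : k + 1 ≤ j := by simpa using hlt
      exact hmono this (by rw [hS]; simp)
    rw [Finset.sum_range_succ, hFX] at h1
    rw [eq_sub_of_add_eq' h1.symm]
    refine sub_mem ⟨_, rfl⟩ (sum_mem fun j hj => ?_)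
    exact (AddSubgroup.zmultiples_le_of_mem (ih j (Finset.mem_range.1 hj))) (hFr _ _ _)
  refine ⟨f, fun y => ?_⟩
  obtain ⟨k, rfl⟩ := hκ y
  exact key k

theorem rh_bounded (p : ℕ) (hp : p.Prime) (n : ℕ) : ∀ (m : ℕ) (G : Type u) [AddCommGroup G]
    [Countable G] [Infinite G], (∀ g : G, p ^ n • g = 0) →
    Nat.card (smulSub G (p ^ (n - 1))) = m →
    ∃ f : G →+ G × ULift.{u} (ZMod p), Surjective f := by
  haveI : NeZero p := ⟨hp.ne_zero⟩
  induction n with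
  | zero =>
    intro m G _ _ _ h0 _
    exfalso
    have : Subsingleton G := ⟨fun a b => by
      have ha := h0 a
      have hb := h0 b
      simp only [pow_zero, one_smul] at ha hb
      rw [ha, hb]⟩
    exact not_finite G
  | succ n ihn =>
    intro m
    induction m using Nat.strong_induction_on with
    | _ m ihm =>
    intro G _ _ _ h0 hcard
    rw [Nat.add_sub_cancel] at hcard
    by_cases hinf : Infinite (smulSub G (p ^ n))
    · apply rh_lemD
      intro S κ
      have hfin : Finite (AddSubgroup.closure (S : Set G)) := by
        haveI : AddGroup.FG (AddSubgroup.closure (S : Set G)) :=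
          (AddGroup.fg_iff_addSubgroup_fg _).2 ⟨S, rfl⟩
        haveI : Module.Finite ℤ (AddSubgroup.closure (S : Set G)) :=
          Module.Finite.iff_addGroup_fg.2 inferInstance
        refine AddCommGroup.finite_of_fg_torsion _ fun y => ?_
        rw [isOfFinAddOrder_iff_nsmul_eq_zero]
        exact ⟨p ^ (n + 1), pow_pos hp.pos _, Subtype.ext (h0 y)⟩
      have hex : ∃ x : G, p ^ n • x ∉ AddSubgroup.closure (S : Set G) := by
        by_contra! hall
        have hle : smulSub G (p ^ n) ≤ AddSubgroup.closure (S : Set G) := by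
          rintro _ ⟨x, rfl⟩
          exact hall x
        have : Finite (smulSub G (p ^ n)) :=
          Finite.of_injective _ (AddSubgroup.inclusion_injective hle)
        exact not_finite (smulSub G (p ^ n))
      obtain ⟨x, hx⟩ := hex
      have hκ : p ^ (n + 1) • κ = 0 := by
        ext
        · exact h0 _
        · simp [pow_succ]
      obtain ⟨f, h1, h2, h3⟩ := rh_lemC p hp (n + 1) n.succ_pos
        (AddSubgroup.closure (S : Set G)) (fun g => by rw [h0]; exact zero_mem _) x hx κ hκ
      exact ⟨f, x, h1, h2, fun g hg => h3 g (AddSubgroup.subset_closure hg)⟩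
    · rw [not_infinite_iff_finite] at hinf
      by_cases hz : ∀ g : G, p ^ n • g = 0
      · exact ihn _ G hz rfl
      push Not at hz
      obtain ⟨x, hx⟩ := hz
      obtain ⟨f, h1, h2, -⟩ := rh_lemC p hp (n + 1) n.succ_pos (⊥ : AddSubgroup G)
        (fun g => by rw [h0]; exact zero_mem _) x (by simpa using hx) x (h0 x)
      have hff : ∀ g, f (f g) = f g := by
        intro g
        obtain ⟨z, hz⟩ := h2 g
        simp only at hz
        rw [← hz, map_zsmul, h1]
      have hker : ∀ g, g - f g ∈ f.ker := by
        intro g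
        rw [AddMonoidHom.mem_ker, map_sub, hff, sub_self]
      have hZfin : Finite (AddSubgroup.zmultiples x) := by
        refine Set.finite_coe_iff.2 (finite_zmultiples.2 ?_)
        rw [isOfFinAddOrder_iff_nsmul_eq_zero]
        exact ⟨p ^ (n + 1), pow_pos hp.pos _, h0 x⟩
      haveI : Infinite f.ker := by
        by_contra hni
        rw [not_infinite_iff_finite] at hni
        have : Finite G := Finite.of_injective
          (fun g => ((⟨f g, h2 g⟩, ⟨g - f g, hker g⟩) : AddSubgroup.zmultiples x × f.ker)) (by
            intro a b hab
            simp only [Prod.mk.injEq, Subtype.mk.injEq] at hab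
            have := hab.2
            rw [hab.1] at this
            exact sub_left_injective this)
        exact not_finite G
      have hlt : Nat.card (smulSub f.ker (p ^ n)) < m := by
        rw [← hcard]
        let ι : smulSub f.ker (p ^ n) → smulSub G (p ^ n) := fun y =>
          ⟨((y : f.ker) : G), by
            obtain ⟨y, z, rfl⟩ := y
            exact ⟨z, rfl⟩⟩
        have hι : Injective ι := by
          intro a b hab
          simp only [ι, Subtype.mk.injEq] at hab
          exact Subtype.ext (Subtype.ext hab)
        have hsurj : ¬ Surjective ι := by
          intro hs
          obtain ⟨y, hy⟩ := hs ⟨p ^ n • x, ⟨x, rfl⟩⟩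
          replace hy : ((y : f.ker) : G) = p ^ n • x := congrArg Subtype.val hy
          have := (y : f.ker).2
          rw [hy, AddMonoidHom.mem_ker, map_nsmul, h1] at this
          exact hx this
        haveI : Finite (smulSub f.ker (p ^ n)) := Finite.of_injective ι hι
        refine lt_of_le_of_ne (Nat.card_le_card_of_injective ι hι) fun heq => hsurj ?_
        exact ((Nat.bijective_iff_injective_and_card ι).2 ⟨hι, heq⟩).2
      obtain ⟨ψ, hψ⟩ := ihm _ hlt f.ker (fun g => Subtype.ext (h0 g)) rfl
      let r : G →+ f.ker := AddMonoidHom.mk' (fun g => ⟨g - f g, hker g⟩) (by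
        intro a b
        apply Subtype.ext
        simp only [map_add, AddSubgroup.coe_add]
        abel)
      have hr : ∀ g, ((r g : f.ker) : G) = g - f g := fun g => rfl
      let θ : G →+ G × ULift.{u} (ZMod p) :=
        AddMonoidHom.prod (f + f.ker.subtype.comp ((AddMonoidHom.fst _ _).comp (ψ.comp r)))
          ((AddMonoidHom.snd _ _).comp (ψ.comp r))
      refine ⟨θ, ?_⟩
      rintro ⟨g, a⟩
      obtain ⟨h, hh⟩ := hψ (r g, a)
      have hfh : f (h : G) = 0 := h.2
      have hrr : r (f g + h) = h := by
        apply Subtype.ext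
        rw [hr, map_add, hff, hfh]; abel
      refine ⟨f g + h, ?_⟩
      have e1 : θ (f g + h) = (f (f g + h) + ((ψ (r (f g + h))).1 : G), (ψ (r (f g + h))).2) := rfl
      rw [e1, hrr, hh, map_add, hff, hfh]
      simp only [hr, Prod.mk.injEq, and_true]
      abel

theorem rh_unbounded (p : ℕ) (hp : p.Prime)
    (G : Type u) [AddCommGroup G] [Countable G] (hG : IsPAddGroup G p)
    (hred : ReducedGroup G) (hb : ∀ n, ∃ g : G, p ^ n • g ≠ 0) (K : Type*) [AddCommGroup K]
    [Countable K] (hK : IsPAddGroup K p) :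
    ∃ f : G →+ K, Surjective f := by
  apply rh_lemD
  intro S κ
  obtain ⟨n, hn⟩ := hK κ
  have hκ : p ^ (n + 1) • κ = 0 := by rw [pow_succ', mul_smul, hn, smul_zero]
  let L : AddSubgroup G := smulSub G (p ^ (n + 1)) ⊔ AddSubgroup.closure (S : Set G)
  have hk : ∃ k, ∀ y ∈ S, p ^ k • y = 0 := by
    choose e he using hG
    refine ⟨S.sup e, fun y hy => ?_⟩
    obtain ⟨d, hd⟩ := Nat.exists_eq_add_of_le (Finset.le_sup (f := e) hy)
    rw [hd, pow_add, mul_comm, mul_smul, he, smul_zero]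
  obtain ⟨k, hk⟩ := hk
  have hk' : ∀ y ∈ AddSubgroup.closure (S : Set G), p ^ k • y = 0 := by
    have : AddSubgroup.closure (S : Set G) ≤ torsionSub G (p ^ k) :=
      (AddSubgroup.closure_le _).2 fun y hy => hk y hy
    exact fun y hy => this hy
  have hex : ∃ x : G, p ^ n • x ∉ L := by
    by_contra! hall
    have hstep : ∀ x : G, ∃ z : G, p ^ (k + n) • x = p • (p ^ (k + n) • z) := by
      intro x
      obtain ⟨_, ⟨z, rfl⟩, s, hs, hsum⟩ := AddSubgroup.mem_sup.1 (hall x)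
      refine ⟨z, ?_⟩
      rw [pow_add, mul_smul, ← hsum, smul_add, hk' s hs, add_zero]
      change p ^ k • (p ^ (n + 1) • z) = _
      rw [smul_smul, smul_smul]
      congr 1
      ring
    have hbot := hred (smulSub G (p ^ (k + n))) (by
      intro q hq
      induction q using Nat.recOnMul with
      | zero => exact absurd hq (lt_irrefl _)
      | one => exact fun x hx => ⟨x, hx, one_smul _ _⟩
      | prime q hqp =>
        intro y hy
        by_cases hqq : q = p
        · subst hqq
          obtain ⟨x, rfl⟩ := hy
          obtain ⟨z, hz⟩ := hstep x
          exact ⟨_, ⟨z, rfl⟩, hz.symm⟩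
        · obtain ⟨e, he⟩ := hG y
          have hc : IsCoprime (q : ℤ) ((p : ℤ) ^ e) :=
            (Nat.isCoprime_iff_coprime.2 ((Nat.coprime_primes hqp hp).2 hqq)).pow_right
          obtain ⟨a, b, hab⟩ := hc
          refine ⟨a • y, zsmul_mem hy a, ?_⟩
          have h2 : ((p : ℤ) ^ e) • y = 0 := by
            have := natCast_zsmul y (p ^ e)
            rw [he] at this
            exact_mod_cast this
          have h3 : ((q : ℤ) * a) • y = (1 - b * (p : ℤ) ^ e) • y := by congr 1; linarith
          rw [← natCast_zsmul, smul_smul, h3, sub_smul, mul_smul, h2, smul_zero, sub_zero,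
            one_smul]
      | mul a b iha ihb =>
        intro y hy
        obtain ⟨z, hz, rfl⟩ := iha (Nat.pos_of_mul_pos_right hq) y hy
        obtain ⟨w, hw, rfl⟩ := ihb (Nat.pos_of_mul_pos_left hq) z hz
        exact ⟨w, hw, mul_smul _ _ _⟩)
    obtain ⟨g, hg⟩ := hb (k + n)
    apply hg
    have : p ^ (k + n) • g ∈ smulSub G (p ^ (k + n)) := ⟨g, rfl⟩
    rw [hbot] at this
    exact this
  obtain ⟨x, hx⟩ := hex
  obtain ⟨f, h1, h2, h3⟩ := rh_lemC p hp (n + 1) n.succ_pos L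
    (fun g => AddSubgroup.mem_sup_left ⟨g, rfl⟩) x hx κ hκ
  exact ⟨f, x, h1, h2, fun g hg =>
    h3 g (AddSubgroup.mem_sup_right (AddSubgroup.subset_closure hg))⟩

/-- Every countable reduced relatively Hopfian `p`-group is finite. -/
theorem finite_of_countable_reduced_relativelyHopfian (p : ℕ) (hp : p.Prime)
    (G : Type u) [AddCommGroup G] [Countable G] (hG : IsPAddGroup G p)
    (hred : ReducedGroup G) (hRH : RelativelyHopfian G) : Finite G := by
  haveI : NeZero p := ⟨hp.ne_zero⟩
  haveI : Fact p.Prime := ⟨hp⟩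
  by_contra hinf
  rw [not_finite_iff_infinite] at hinf
  have hA : ∃ f : G →+ G × ULift.{u} (ZMod p), Surjective f := by
    by_cases hb : ∃ n, ∀ g : G, p ^ n • g = 0
    · obtain ⟨n, hn⟩ := hb
      exact rh_bounded p hp n _ G hn rfl
    · push Not at hb
      refine rh_unbounded p hp G hG hred hb _ ?_
      rintro ⟨g, a⟩
      obtain ⟨n, hn⟩ := hG g
      refine ⟨n + 1, ?_⟩
      ext
      · simp [pow_succ', mul_smul, hn]
      · simp [pow_succ]
  obtain ⟨f, hf⟩ := hA
  have := hRH _ f hf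
  exact not_subsingleton (ULift.{u} (ZMod p)) this
end

section
/- Let G be an abelian group and B a fully invariant subgroup of G such that G/B is Hopfian. If B is Hopfian (respectively, relatively Hopfian, weakly Hopfian, directly finite), then G is Hopfian (respectively, relatively Hopfian, weakly Hopfian, directly finite). -/
open Function

universe u

/-- Surjective endomorphisms reflect membership in `B`. -/
theorem mem_of_map_mem_aux (G : Type u) [AddCommGroup G]
    (B : AddSubgroup G) (hB : ∀ φ : G →+ G, ∀ x ∈ B, φ x ∈ B)
    (hquot : Hopfian (G ⧸ B)) (φ : G →+ G) (hφ : Surjective φ) (x : G) (hx : φ x ∈ B) :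
    x ∈ B := by
  have hinj := hquot (QuotientAddGroup.map B B φ (fun y hy => hB φ y hy)) (by
    intro y
    induction y using QuotientAddGroup.induction_on with
    | _ a =>
      obtain ⟨g, rfl⟩ := hφ a
      exact ⟨(g : G ⧸ B), rfl⟩)
  rw [← QuotientAddGroup.eq_zero_iff]
  apply hinj
  rw [map_zero]
  exact (QuotientAddGroup.eq_zero_iff _).2 hx

/-- Restriction of an endomorphism to `B`. -/
def restrAux {G : Type u} [AddCommGroup G]
    (B : AddSubgroup G) (φ : G →+ G) (h : ∀ x ∈ B, φ x ∈ B) : B →+ B :=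
  (φ.comp B.subtype).codRestrict B (fun x => h x x.2)

/-- Restriction of a map `G → G × A` to `B → B × A`. -/
def restrProdAux {G A : Type u} [AddCommGroup G] [AddCommGroup A]
    (B : AddSubgroup G) (φ : G →+ G × A) (h : ∀ x ∈ B, (φ x).1 ∈ B) : B →+ B × A :=
  (restrAux B ((AddMonoidHom.fst G A).comp φ) h).prod
    (((AddMonoidHom.snd G A).comp φ).comp B.subtype)

theorem restrAux_surjective {G : Type u} [AddCommGroup G]
    (B : AddSubgroup G) (φ : G →+ G) (h : ∀ x ∈ B, φ x ∈ B) (hs : Surjective φ)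
    (h' : ∀ x, φ x ∈ B → x ∈ B) : Surjective (restrAux B φ h) := by
  rintro ⟨b, hb⟩
  obtain ⟨g, rfl⟩ := hs b
  exact ⟨⟨g, h' g hb⟩, rfl⟩

theorem restrProdAux_surjective {G A : Type u} [AddCommGroup G] [AddCommGroup A]
    (B : AddSubgroup G) (φ : G →+ G × A) (h : ∀ x ∈ B, (φ x).1 ∈ B) (hs : Surjective φ)
    (h' : ∀ x, (φ x).1 ∈ B → x ∈ B) : Surjective (restrProdAux B φ h) := by
  rintro ⟨⟨b, hb⟩, a⟩
  obtain ⟨g, hg⟩ := hs (b, a)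
  have h1 : (φ g).1 = b := by rw [hg]
  have h2 : (φ g).2 = a := by rw [hg]
  exact ⟨⟨g, h' g (h1 ▸ hb)⟩, Prod.ext (Subtype.ext h1) h2⟩

/-- If `B` is a fully invariant subgroup of `G` with `G/B` Hopfian,
and `B` is in one of the four classes, then `G` is in the same class. -/
theorem classes_of_fully_invariant_with_hopfian_quotient (G : Type u) [AddCommGroup G]
    (B : AddSubgroup G) (hB : ∀ φ : G →+ G, ∀ x ∈ B, φ x ∈ B)
    (hquot : Hopfian (G ⧸ B)) :
    (Hopfian ↥B → Hopfian G) ∧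
    (RelativelyHopfian ↥B → RelativelyHopfian G) ∧
    (WeaklyHopfian ↥B → WeaklyHopfian G) ∧
    (DirectlyFinite ↥B → DirectlyFinite G) := by
  have key := mem_of_map_mem_aux G B hB hquot
  have inj : ∀ φ : G →+ G, Surjective φ → Injective (restrAux B φ (hB φ)) → Injective φ := by
    intro φ hs hi
    rw [injective_iff_map_eq_zero]
    intro x hx
    have hxB : x ∈ B := key φ hs x (by rw [hx]; exact B.zero_mem)
    have := (injective_iff_map_eq_zero _).1 hi ⟨x, hxB⟩ (Subtype.ext hx)
    exact congrArg Subtype.val this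
  have fstS : ∀ (A : Type u) [AddCommGroup A] (φ : G →+ G × A), Surjective φ →
      Surjective ((AddMonoidHom.fst G A).comp φ) := by
    intro A _ φ hs g
    obtain ⟨x, hx⟩ := hs (g, 0)
    exact ⟨x, congrArg Prod.fst hx⟩
  refine ⟨fun H φ hs => ?_, fun H A _ φ hs => ?_, fun H φ hs hp => ?_, fun H A _ e => ?_⟩
  · exact inj φ hs (H _ (restrAux_surjective B φ (hB φ) hs (key φ hs)))
  · exact H A _ (restrProdAux_surjective B φ (hB ((AddMonoidHom.fst G A).comp φ)) hs
      (key _ (fstS A φ hs)))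
  · refine inj φ hs (H _ (restrAux_surjective B φ (hB φ) hs (key φ hs)) ?_)
    rintro n hn ⟨x, hxB⟩ hx ⟨g, hg⟩
    have hx0 : φ x = 0 := congrArg Subtype.val (show restrAux B φ (hB φ) ⟨x, hxB⟩ = 0 from hx)
    obtain ⟨y, hy, hyx⟩ := hp n hn x hx0 ⟨g, congrArg Subtype.val hg⟩
    have hy0 : φ y = 0 := hy
    exact ⟨⟨y, key φ hs y (by rw [hy0]; exact B.zero_mem)⟩, Subtype.ext hy0, Subtype.ext hyx⟩
  · have hs : Surjective (e : G →+ G × A) := e.surjective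
    refine H A (AddEquiv.ofBijective (restrProdAux B (e : G →+ G × A)
      (hB ((AddMonoidHom.fst G A).comp (e : G →+ G × A)))) ⟨?_,
        restrProdAux_surjective B _ _ hs (key _ (fstS A _ hs))⟩)
    intro x y hxy
    apply Subtype.ext
    apply e.injective
    exact Prod.ext (congrArg (fun z => (z.1 : G)) hxy) (congrArg (fun z => z.2) hxy)
end
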